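/- arXiv:2004.07824 — 2 statements merged into one kernel-verified Lean document; each statement's English description precedes it below -/
import Mathlib

section
/- Intertwining of the tilde projections with the shift operators: Θ_Z̃ Ỹ_+ = Y_+ Θ_Z̃ and Θ_Ỹ Z̃_+ = Z_+ Θ_Ỹ on 𝒫_{Ỹ,Z̃}, i.e. for every f ∈ 𝒫_{Ỹ,Z̃}, Θ_Z̃(Ỹ_+ f) = Y_+(Θ_Z̃ f) and Θ_Ỹ(Z̃_+ f) = Z_+(Θ_Ỹ f). -/
open MvPolynomial

noncomputable section

/-- The base field `K = ℚ(b)`: rational functions in an indeterminate `b` over `ℚ`. -/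
abbrev K : Type := RatFunc ℚ

/-- The indeterminate `b ∈ K`. -/
def bb : K := RatFunc.X

/-- `α = 1 + b`. -/
def alpha : K := 1 + bb

/-- Variables: `p i` (used for `i ≥ 1`) and `y i`, `y' i`, `z i`, `z' i` (`i ≥ 0`). -/
inductive Var : Type
  | p : ℕ → Var
  | y : ℕ → Var
  | y' : ℕ → Var
  | z : ℕ → Var
  | z' : ℕ → Var
  deriving DecidableEq

/-- The ambient polynomial ring `R′`. -/
abbrev R : Type := MvPolynomial Var K

/-- The generic operator
`Λ_A = α Σ_{i,j≥1} i a_{i+j−1} ∂²/∂p_i∂a_{j−1} + Σ_{i,j≥1} a_{i−1} p_j ∂/∂a_{i+j−1}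
     + b Σ_{i≥1} i a_i ∂/∂a_i` for the alphabet `a ∈ {y, y′, z, z′}`. -/
def Lam (a : ℕ → Var) (f : R) : R :=
  alpha • (∑ᶠ (i : ℕ) (j : ℕ), ((i + 1 : ℕ) : K) •
      (X (a (i + j + 1)) * pderiv (Var.p (i + 1)) (pderiv (a j) f)))
    + (∑ᶠ (i : ℕ) (j : ℕ), X (a i) * X (Var.p (j + 1)) * pderiv (a (i + j + 1)) f)
    + bb • (∑ᶠ (i : ℕ), ((i + 1 : ℕ) : K) • (X (a (i + 1)) * pderiv (a (i + 1)) f))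

/-- The generic shift operator `A_+ = Σ_{i≥0} a_{i+1} ∂/∂a_i`. -/
def Plus (a : ℕ → Var) (f : R) : R := ∑ᶠ (i : ℕ), X (a (i + 1)) * pderiv (a i) f

/-- The generic operator `Θ_A = Σ_{i≥1} p_i ∂/∂a_i`. -/
def Theta (a : ℕ → Var) (f : R) : R := ∑ᶠ (i : ℕ), X (Var.p (i + 1)) * pderiv (a (i + 1)) f

/-- `M_Z = α Σ_{i,j,k≥1} y′_{i+j−1} z′_{k−1} ∂²/∂y_{i+k−1}∂z_{j−1}
         + Σ_{i,j,k≥1} y_{i+j−1} z_{k−1} ∂²/∂y′_{i+k−1}∂z′_{j−1}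
         + b Σ_{i,j,k≥1} y′_{i+j−1} z′_{k−1} ∂²/∂y′_{i+k−1}∂z′_{j−1}`. -/
def MZ (f : R) : R :=
  alpha • (∑ᶠ (i : ℕ) (j : ℕ) (k : ℕ), X (Var.y' (i + j + 1)) * X (Var.z' k) *
      pderiv (Var.y (i + k + 1)) (pderiv (Var.z j) f))
    + (∑ᶠ (i : ℕ) (j : ℕ) (k : ℕ), X (Var.y (i + j + 1)) * X (Var.z k) *
      pderiv (Var.y' (i + k + 1)) (pderiv (Var.z' j) f))
    + bb • (∑ᶠ (i : ℕ) (j : ℕ) (k : ℕ), X (Var.y' (i + j + 1)) * X (Var.z' k) *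
      pderiv (Var.y' (i + k + 1)) (pderiv (Var.z' j) f))

/-- `M_Y`: obtained from `M_Z` by exchanging `y ↔ z` and `y′ ↔ z′` everywhere. -/
def MY (f : R) : R :=
  alpha • (∑ᶠ (i : ℕ) (j : ℕ) (k : ℕ), X (Var.z' (i + j + 1)) * X (Var.y' k) *
      pderiv (Var.z (i + k + 1)) (pderiv (Var.y j) f))
    + (∑ᶠ (i : ℕ) (j : ℕ) (k : ℕ), X (Var.z (i + j + 1)) * X (Var.y k) *
      pderiv (Var.z' (i + k + 1)) (pderiv (Var.y' j) f))
    + bb • (∑ᶠ (i : ℕ) (j : ℕ) (k : ℕ), X (Var.z' (i + j + 1)) * X (Var.y' k) *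
      pderiv (Var.z' (i + k + 1)) (pderiv (Var.y' j) f))

/-- `Λ_Ỹ = Λ_Y + Λ_{Y′} + M_Y`. -/
def LamYt (f : R) : R := Lam Var.y f + Lam Var.y' f + MY f

/-- `Λ_Z̃ = Λ_Z + Λ_{Z′} + M_Z`. -/
def LamZt (f : R) : R := Lam Var.z f + Lam Var.z' f + MZ f

/-- `Ỹ_+ = Y_+ + Y′_+`. -/
def Ytplus (f : R) : R := Plus Var.y f + Plus Var.y' f

/-- `Z̃_+ = Z_+ + Z′_+`. -/
def Ztplus (f : R) : R := Plus Var.z f + Plus Var.z' f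

/-- `Θ_Z̃ = ∂/∂z₀ + Σ_{i≥1} p_i ∂/∂z_i + Σ_{i,j≥0} y_{i+j} ∂²/∂y′_i∂z′_j`. -/
def ThZt (f : R) : R :=
  pderiv (Var.z 0) f + (∑ᶠ (i : ℕ), X (Var.p (i + 1)) * pderiv (Var.z (i + 1)) f)
    + (∑ᶠ (i : ℕ) (j : ℕ), X (Var.y (i + j)) * pderiv (Var.y' i) (pderiv (Var.z' j) f))

/-- `Θ_Ỹ = ∂/∂y₀ + Σ_{i≥1} p_i ∂/∂y_i + Σ_{i,j≥0} z_{i+j} ∂²/∂z′_i∂y′_j`. -/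
def ThYt (f : R) : R :=
  pderiv (Var.y 0) f + (∑ᶠ (i : ℕ), X (Var.p (i + 1)) * pderiv (Var.y (i + 1)) f)
    + (∑ᶠ (i : ℕ) (j : ℕ), X (Var.z (i + j)) * pderiv (Var.z' i) (pderiv (Var.y' j) f))

/-- `Δ = α Σ_{i,j≥0} z′_i y′_j ∂²/∂y_i∂z_j + Σ_{i,j≥0} z_i y_j ∂²/∂y′_i∂z′_j
      + b Σ_{i,j≥0} z′_i y′_j ∂²/∂y′_i∂z′_j`. -/
def Delta (f : R) : R :=
  alpha • (∑ᶠ (i : ℕ) (j : ℕ), X (Var.z' i) * X (Var.y' j) *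
      pderiv (Var.y i) (pderiv (Var.z j) f))
    + (∑ᶠ (i : ℕ) (j : ℕ), X (Var.z i) * X (Var.y j) *
      pderiv (Var.y' i) (pderiv (Var.z' j) f))
    + bb • (∑ᶠ (i : ℕ) (j : ℕ), X (Var.z' i) * X (Var.y' j) *
      pderiv (Var.y' i) (pderiv (Var.z' j) f))

/-- `𝒫`: the subalgebra of polynomials in the `p`-variables only. -/
def Psub : Subalgebra K R := MvPolynomial.supported K (Set.range Var.p)

/-- `𝒫_Y`: the `K`-linear span of the monomials `p_λ` and `y_i·p_λ`. -/
def PY : Submodule K R :=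
  Submodule.span K ((Psub : Set R) ∪
    {g : R | ∃ i : ℕ, ∃ f ∈ (Psub : Set R), g = X (Var.y i) * f})

/-- `𝒫_{Ỹ,Z̃}`: the `K`-linear span of the monomials
`p_λ, y_i·p_λ, z_j·p_λ, y_i·z_j·p_λ, y′_i·p_λ, z′_j·p_λ, y′_i·z′_j·p_λ`. -/
def PYZt : Submodule K R :=
  Submodule.span K ((Psub : Set R) ∪
    {g : R | ∃ f ∈ (Psub : Set R),
      (∃ i : ℕ, g = X (Var.y i) * f) ∨ (∃ j : ℕ, g = X (Var.z j) * f) ∨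
      (∃ i : ℕ, ∃ j : ℕ, g = X (Var.y i) * X (Var.z j) * f) ∨
      (∃ i : ℕ, g = X (Var.y' i) * f) ∨ (∃ j : ℕ, g = X (Var.z' j) * f) ∨
      (∃ i : ℕ, ∃ j : ℕ, g = X (Var.y' i) * X (Var.z' j) * f)})

/-- Only finitely many partial derivatives along an injective family of variables are nonzero. -/
theorem finite_pderiv_ne_zero {a : ℕ → Var} (ha : Function.Injective a) (f : R) :
    {i | pderiv (a i) f ≠ 0}.Finite := by
  refine (f.vars.finite_toSet.preimage ha.injOn).subset fun i hi => ?_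
  by_contra h
  exact hi (pderiv_eq_zero_of_notMem_vars h)

/-- The `K`-linear map `f ↦ ∑ i, D i f` attached to a locally finite family of endomorphisms. -/
def locallyFiniteSum (D : ℕ → R →ₗ[K] R)
    (hD : ∀ f, (Function.support fun i => D i f).Finite) : R →ₗ[K] R where
  toFun f := ∑ᶠ i, D i f
  map_add' f g := by
    simp only [map_add]
    exact finsum_add_distrib (hD f) (hD g)
  map_smul' c f := by
    simp only [map_smul, RingHom.id_apply]
    exact (smul_finsum' c (hD f)).symm

/-- `f ↦ ∑ i, c i * ∂f/∂a_i` as a linear map. -/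
def sumPderiv (c : ℕ → R) {a : ℕ → Var} (ha : Function.Injective a) : R →ₗ[K] R :=
  locallyFiniteSum (fun i => LinearMap.mulLeft K (c i) ∘ₗ (pderiv (a i)).toLinearMap)
    fun f => (finite_pderiv_ne_zero ha f).subset fun i hi h => hi (by
      simp [h])

theorem sumPderiv_apply (c : ℕ → R) {a : ℕ → Var} (ha : Function.Injective a) (f : R) :
    sumPderiv c ha f = ∑ᶠ i, c i * pderiv (a i) f := rfl

/-- `f ↦ ∑ i j, c i j * ∂²f/∂a_i∂b_j` as a linear map. -/
def sumPderivPderiv (c : ℕ → ℕ → R) {a b : ℕ → Var} (ha : Function.Injective a)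
    (hb : Function.Injective b) : R →ₗ[K] R :=
  locallyFiniteSum (fun i => sumPderiv (c i) hb ∘ₗ (pderiv (a i)).toLinearMap)
    fun f => (finite_pderiv_ne_zero ha f).subset fun i hi h => hi (by
      simp [h])

/-- Partial derivatives of a polynomial commute. -/
theorem pderiv_comm (v w : Var) (f : R) : pderiv v (pderiv w f) = pderiv w (pderiv v f) := by
  have h : ⁅(pderiv v : Derivation K R R), (pderiv w : Derivation K R R)⁆ = 0 := by
    refine MvPolynomial.derivation_ext fun u => ?_
    classical
    simp [Derivation.commutator_apply, pderiv_X, Pi.single_apply, apply_ite]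
  have := congrArg (fun D : Derivation K R R => D f) h
  simpa [Derivation.commutator_apply, sub_eq_zero] using this

theorem sumPderivPderiv_apply (c : ℕ → ℕ → R) {a b : ℕ → Var} (ha : Function.Injective a)
    (hb : Function.Injective b) (f : R) :
    sumPderivPderiv c ha hb f = ∑ᶠ (i : ℕ) (j : ℕ), c i j * pderiv (a i) (pderiv (b j) f) := by
  simp only [pderiv_comm (a _) (b _)]
  rfl

/-- `f` does not involve the letters `a_i`. -/
def FreeOf (a : ℕ → Var) (f : R) : Prop := ∀ i, pderiv (a i) f = 0

theorem FreeOf.mul {a : ℕ → Var} {f g : R} (hf : FreeOf a f) (hg : FreeOf a g) :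
    FreeOf a (f * g) := fun i => by simp [Derivation.leibniz, hf i, hg i]

theorem freeOf_X {a : ℕ → Var} {v : Var} (h : ∀ i, v ≠ a i) : FreeOf a (X v) :=
  fun i => pderiv_X_of_ne (h i)

theorem freeOf_of_mem_Psub {a : ℕ → Var} (h : ∀ i n, a i ≠ Var.p n) {f : R} (hf : f ∈ Psub) :
    FreeOf a f := fun i => by
  refine pderiv_eq_zero_of_notMem_vars fun hi => ?_
  obtain ⟨n, hn⟩ := (mem_supported.1 hf) hi
  exact h i n hn.symm

theorem sumPderiv_eq_zero (c : ℕ → R) {a : ℕ → Var} (ha : Function.Injective a) {f : R}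
    (hf : FreeOf a f) : sumPderiv c ha f = 0 := by
  simp [sumPderiv_apply, hf _]

theorem pderiv_X_mul {a : ℕ → Var} (ha : Function.Injective a) {f : R} (hf : FreeOf a f)
    (i k : ℕ) : pderiv (a k) (X (a i) * f) = if k = i then f else 0 := by
  split_ifs with h
  · subst h; simp [Derivation.leibniz, hf k]
  · simp [Derivation.leibniz, hf k, pderiv_X_of_ne (ha.ne (Ne.symm h))]

theorem sumPderiv_X_mul (c : ℕ → R) {a : ℕ → Var} (ha : Function.Injective a) {f : R}
    (hf : FreeOf a f) (i : ℕ) : sumPderiv c ha (X (a i) * f) = c i * f := by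
  rw [sumPderiv_apply, finsum_eq_single _ i fun k hk => by simp [pderiv_X_mul ha hf, hk]]
  simp [pderiv_X_mul ha hf]

theorem sumPderivPderiv_eq_zero_left (c : ℕ → ℕ → R) {a b : ℕ → Var}
    (ha : Function.Injective a) (hb : Function.Injective b) {f : R} (hf : FreeOf a f) :
    sumPderivPderiv c ha hb f = 0 := by
  simp [sumPderivPderiv_apply, pderiv_comm (a _), hf _]

theorem sumPderivPderiv_eq_zero_right (c : ℕ → ℕ → R) {a b : ℕ → Var}
    (ha : Function.Injective a) (hb : Function.Injective b) {f : R} (hf : FreeOf b f) :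
    sumPderivPderiv c ha hb f = 0 := by
  simp [sumPderivPderiv_apply, hf _]

theorem sumPderivPderiv_X_mul_X_mul (c : ℕ → ℕ → R) {a b : ℕ → Var}
    (ha : Function.Injective a) (hb : Function.Injective b) (hab : ∀ i j, b j ≠ a i) {f : R}
    (hfa : FreeOf a f) (hfb : FreeOf b f) (i j : ℕ) :
    sumPderivPderiv c ha hb (X (a i) * (X (b j) * f)) = c i j * f := by
  have h := (freeOf_X fun i => hab i j).mul hfa
  change ∑ᶠ k, sumPderiv (c k) hb (pderiv (a k) (X (a i) * (X (b j) * f))) = _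
  rw [finsum_eq_single _ i fun k hk => by simp [pderiv_X_mul ha h, hk]]
  simp [pderiv_X_mul ha h, sumPderiv_X_mul (c i) hb hfb]

/-- Four families of letters, distinct from each other and from the `p`-variables; they play the
roles of `y, y', z, z'` up to order. -/
structure Alphabets (u u' v v' : ℕ → Var) : Prop where
  inj_u : Function.Injective u
  inj_u' : Function.Injective u'
  inj_v : Function.Injective v
  inj_v' : Function.Injective v'
  u_ne_u' : ∀ i j, u i ≠ u' j
  u_ne_v : ∀ i j, u i ≠ v j
  u_ne_v' : ∀ i j, u i ≠ v' j
  u'_ne_v : ∀ i j, u' i ≠ v j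
  u'_ne_v' : ∀ i j, u' i ≠ v' j
  v_ne_v' : ∀ i j, v i ≠ v' j
  u_ne_p : ∀ i n, u i ≠ Var.p n
  u'_ne_p : ∀ i n, u' i ≠ Var.p n
  v_ne_p : ∀ i n, v i ≠ Var.p n
  v'_ne_p : ∀ i n, v' i ≠ Var.p n

namespace Alphabets

variable {u u' v v' : ℕ → Var}

/-- The shift operator `U_+ + U'_+` as a linear map. -/
def shiftTilde (h : Alphabets u u' v v') : R →ₗ[K] R :=
  sumPderiv (fun i => X (u (i + 1))) h.inj_u + sumPderiv (fun i => X (u' (i + 1))) h.inj_u'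

/-- The image of `v_j` under the tilde projection: `1` for `j = 0` and `p_j` otherwise. -/
def weight (j : ℕ) : R := if j = 0 then 1 else X (Var.p j)

/-- The tilde projection eliminating the letters `v, v'`, as a linear map. -/
def projTilde (h : Alphabets u u' v v') : R →ₗ[K] R :=
  sumPderiv weight h.inj_v + sumPderivPderiv (fun i j => X (u (i + j))) h.inj_u' h.inj_v'

theorem projTilde_apply (h : Alphabets u u' v v') (f : R) :
    h.projTilde f = pderiv (v 0) f
      + (∑ᶠ (i : ℕ), X (Var.p (i + 1)) * pderiv (v (i + 1)) f)
      + (∑ᶠ (i : ℕ) (j : ℕ), X (u (i + j)) * pderiv (u' i) (pderiv (v' j) f)) := by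
  rw [projTilde, LinearMap.add_apply, sumPderivPderiv_apply, sumPderiv_apply]
  congr 1
  have hfin : (Function.support fun i => weight i * pderiv (v i) f).Finite :=
    (finite_pderiv_ne_zero h.inj_v f).subset fun i hi h0 => hi (by simp [h0])
  have hfin' : (Function.support fun i => weight (i + 1) * pderiv (v (i + 1)) f).Finite :=
    hfin.preimage (add_left_injective 1).injOn
  obtain ⟨N, hN⟩ := hfin.bddAbove
  rw [finsum_eq_sum_of_support_subset (s := Finset.range (N + 1)),
    Finset.sum_range_succ', add_comm, ← finsum_eq_sum_of_support_subset]
  · simp [weight]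
  · intro i hi
    have := hN (show i + 1 ∈ Function.support fun i => weight i * pderiv (v i) f from by
      simpa [weight] using hi)
    simp only [Finset.coe_range, Set.mem_Iio]
    omega
  · intro i hi
    have := hN hi
    simp only [Finset.coe_range, Set.mem_Iio]
    omega

/-- The polynomials on which the tilde projection intertwines the shift operators. -/
def intertwined (h : Alphabets u u' v v') : Submodule K R :=
  LinearMap.eqLocus (h.projTilde ∘ₗ h.shiftTilde)
    (sumPderiv (fun i => X (u (i + 1))) h.inj_u ∘ₗ h.projTilde)

theorem mem_intertwined (h : Alphabets u u' v v') (f : R) :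
    f ∈ h.intertwined ↔
      h.projTilde (h.shiftTilde f) = sumPderiv (fun i => X (u (i + 1))) h.inj_u (h.projTilde f) :=
  Iff.rfl

theorem weight_mul_mem_Psub (j : ℕ) {f : R} (hf : f ∈ Psub) : weight j * f ∈ Psub := by
  refine mul_mem ?_ hf
  unfold weight
  split_ifs
  · exact one_mem _
  · exact X_mem_supported.2 ⟨j, rfl⟩

theorem projTilde_eq_zero (h : Alphabets u u' v v') {f : R} (hv : FreeOf v f)
    (h' : FreeOf u' f ∨ FreeOf v' f) : h.projTilde f = 0 := by
  rw [projTilde, LinearMap.add_apply, sumPderiv_eq_zero _ _ hv, zero_add]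
  exact h'.elim (sumPderivPderiv_eq_zero_left _ _ _) (sumPderivPderiv_eq_zero_right _ _ _)

theorem projTilde_X_mul (h : Alphabets u u' v v') {f : R} (hu' : FreeOf u' f) (hv : FreeOf v f)
    (j : ℕ) : h.projTilde (X (v j) * f) = weight j * f := by
  rw [projTilde, LinearMap.add_apply, sumPderiv_X_mul _ _ hv, sumPderivPderiv_eq_zero_left,
    add_zero]
  exact (freeOf_X fun i => (h.u'_ne_v i j).symm).mul hu'

theorem projTilde_X_mul_X_mul (h : Alphabets u u' v v') {f : R} (hu' : FreeOf u' f)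
    (hv : FreeOf v f) (hv' : FreeOf v' f) (i j : ℕ) :
    h.projTilde (X (u' i) * (X (v' j) * f)) = X (u (i + j)) * f := by
  rw [projTilde, LinearMap.add_apply, sumPderivPderiv_X_mul_X_mul _ _ _
    (fun i j => (h.u'_ne_v' i j).symm) hu' hv', sumPderiv_eq_zero, zero_add]
  exact (freeOf_X fun k => h.u'_ne_v i k).mul ((freeOf_X fun k => (h.v_ne_v' k j).symm).mul hv)

theorem shiftTilde_eq_zero (h : Alphabets u u' v v') {f : R} (hu : FreeOf u f)
    (hu' : FreeOf u' f) : h.shiftTilde f = 0 := by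
  simp [shiftTilde, sumPderiv_eq_zero, hu, hu']

theorem shiftTilde_X_mul (h : Alphabets u u' v v') {f : R} (hu : FreeOf u f) (hu' : FreeOf u' f)
    (i : ℕ) : h.shiftTilde (X (u i) * f) = X (u (i + 1)) * f := by
  rw [shiftTilde, LinearMap.add_apply, sumPderiv_X_mul _ _ hu, sumPderiv_eq_zero, add_zero]
  exact (freeOf_X (h.u_ne_u' i)).mul hu'

theorem shiftTilde_X'_mul (h : Alphabets u u' v v') {f : R} (hu : FreeOf u f) (hu' : FreeOf u' f)
    (i : ℕ) : h.shiftTilde (X (u' i) * f) = X (u' (i + 1)) * f := by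
  rw [shiftTilde, LinearMap.add_apply, sumPderiv_X_mul _ _ hu', sumPderiv_eq_zero, zero_add]
  exact (freeOf_X fun k => (h.u_ne_u' k i).symm).mul hu

section Generators

variable (h : Alphabets u u' v v') {f : R} (hf : f ∈ Psub)
include h hf

theorem freeOf_u : FreeOf u f := freeOf_of_mem_Psub h.u_ne_p hf

theorem freeOf_u' : FreeOf u' f := freeOf_of_mem_Psub h.u'_ne_p hf

theorem freeOf_v : FreeOf v f := freeOf_of_mem_Psub h.v_ne_p hf

theorem freeOf_v' : FreeOf v' f := freeOf_of_mem_Psub h.v'_ne_p hf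

theorem mem_intertwined_of_mem_Psub : f ∈ h.intertwined := by
  rw [mem_intertwined, h.shiftTilde_eq_zero (h.freeOf_u hf) (h.freeOf_u' hf),
    h.projTilde_eq_zero (h.freeOf_v hf) (.inl (h.freeOf_u' hf)), map_zero, map_zero]

theorem X_u_mul_mem_intertwined (i : ℕ) : X (u i) * f ∈ h.intertwined := by
  have hz (k : ℕ) : h.projTilde (X (u k) * f) = 0 :=
    h.projTilde_eq_zero ((freeOf_X (h.u_ne_v k)).mul (h.freeOf_v hf))
      (.inl ((freeOf_X (h.u_ne_u' k)).mul (h.freeOf_u' hf)))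
  rw [mem_intertwined, h.shiftTilde_X_mul (h.freeOf_u hf) (h.freeOf_u' hf), hz, hz, map_zero]

theorem X_v_mul_mem_intertwined (j : ℕ) : X (v j) * f ∈ h.intertwined := by
  rw [mem_intertwined, h.shiftTilde_eq_zero
    ((freeOf_X fun k => (h.u_ne_v k j).symm).mul (h.freeOf_u hf))
    ((freeOf_X fun k => (h.u'_ne_v k j).symm).mul (h.freeOf_u' hf)),
    h.projTilde_X_mul (h.freeOf_u' hf) (h.freeOf_v hf), map_zero,
    sumPderiv_eq_zero _ _ (h.freeOf_u (weight_mul_mem_Psub j hf))]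

theorem X_u_mul_X_v_mul_mem_intertwined (i j : ℕ) : X (u i) * (X (v j) * f) ∈ h.intertwined := by
  have hz (k : ℕ) : h.projTilde (X (u k) * (X (v j) * f)) = X (u k) * (weight j * f) := by
    rw [mul_left_comm, h.projTilde_X_mul ((freeOf_X (h.u_ne_u' k)).mul (h.freeOf_u' hf))
      ((freeOf_X (h.u_ne_v k)).mul (h.freeOf_v hf)), mul_left_comm]
  rw [mem_intertwined, h.shiftTilde_X_mul
    ((freeOf_X fun k => (h.u_ne_v k j).symm).mul (h.freeOf_u hf))
    ((freeOf_X fun k => (h.u'_ne_v k j).symm).mul (h.freeOf_u' hf)), hz, hz,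
    sumPderiv_X_mul _ _ (h.freeOf_u (weight_mul_mem_Psub j hf))]

theorem X_u'_mul_mem_intertwined (i : ℕ) : X (u' i) * f ∈ h.intertwined := by
  have hz (k : ℕ) : h.projTilde (X (u' k) * f) = 0 :=
    h.projTilde_eq_zero ((freeOf_X (h.u'_ne_v k)).mul (h.freeOf_v hf))
      (.inr ((freeOf_X (h.u'_ne_v' k)).mul (h.freeOf_v' hf)))
  rw [mem_intertwined, h.shiftTilde_X'_mul (h.freeOf_u hf) (h.freeOf_u' hf), hz, hz, map_zero]

theorem X_v'_mul_mem_intertwined (j : ℕ) : X (v' j) * f ∈ h.intertwined := by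
  have hu' : FreeOf u' (X (v' j) * f) :=
    (freeOf_X fun k => (h.u'_ne_v' k j).symm).mul (h.freeOf_u' hf)
  rw [mem_intertwined, h.shiftTilde_eq_zero
    ((freeOf_X fun k => (h.u_ne_v' k j).symm).mul (h.freeOf_u hf)) hu',
    h.projTilde_eq_zero ((freeOf_X fun k => (h.v_ne_v' k j).symm).mul (h.freeOf_v hf)) (.inl hu'),
    map_zero, map_zero]

theorem X_u'_mul_X_v'_mul_mem_intertwined (i j : ℕ) :
    X (u' i) * (X (v' j) * f) ∈ h.intertwined := by
  rw [mem_intertwined, h.shiftTilde_X'_mul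
    ((freeOf_X fun k => (h.u_ne_v' k j).symm).mul (h.freeOf_u hf))
    ((freeOf_X fun k => (h.u'_ne_v' k j).symm).mul (h.freeOf_u' hf)),
    h.projTilde_X_mul_X_mul (h.freeOf_u' hf) (h.freeOf_v hf) (h.freeOf_v' hf),
    h.projTilde_X_mul_X_mul (h.freeOf_u' hf) (h.freeOf_v hf) (h.freeOf_v' hf),
    sumPderiv_X_mul _ _ (h.freeOf_u hf), Nat.add_right_comm]

end Generators

end Alphabets

theorem alphabets_y_z : Alphabets Var.y Var.y' Var.z Var.z' := by
  constructor <;> intro i j <;> simp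

theorem alphabets_z_y : Alphabets Var.z Var.z' Var.y Var.y' := by
  constructor <;> intro i j <;> simp

theorem PYZt_le_intertwined_y_z : PYZt ≤ alphabets_y_z.intertwined := by
  refine Submodule.span_le.2 ?_
  rintro g (hg | ⟨f, hf, ⟨i, rfl⟩ | ⟨j, rfl⟩ | ⟨i, j, rfl⟩ | ⟨i, rfl⟩ | ⟨j, rfl⟩ | ⟨i, j, rfl⟩⟩)
  · exact alphabets_y_z.mem_intertwined_of_mem_Psub hg
  · exact alphabets_y_z.X_u_mul_mem_intertwined hf i
  · exact alphabets_y_z.X_v_mul_mem_intertwined hf j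
  · rw [mul_assoc]
    exact alphabets_y_z.X_u_mul_X_v_mul_mem_intertwined hf i j
  · exact alphabets_y_z.X_u'_mul_mem_intertwined hf i
  · exact alphabets_y_z.X_v'_mul_mem_intertwined hf j
  · rw [mul_assoc]
    exact alphabets_y_z.X_u'_mul_X_v'_mul_mem_intertwined hf i j

theorem PYZt_le_intertwined_z_y : PYZt ≤ alphabets_z_y.intertwined := by
  refine Submodule.span_le.2 ?_
  rintro g (hg | ⟨f, hf, ⟨i, rfl⟩ | ⟨j, rfl⟩ | ⟨i, j, rfl⟩ | ⟨i, rfl⟩ | ⟨j, rfl⟩ | ⟨i, j, rfl⟩⟩)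
  · exact alphabets_z_y.mem_intertwined_of_mem_Psub hg
  · exact alphabets_z_y.X_v_mul_mem_intertwined hf i
  · exact alphabets_z_y.X_u_mul_mem_intertwined hf j
  · rw [mul_assoc, mul_left_comm]
    exact alphabets_z_y.X_u_mul_X_v_mul_mem_intertwined hf j i
  · exact alphabets_z_y.X_v'_mul_mem_intertwined hf i
  · exact alphabets_z_y.X_u'_mul_mem_intertwined hf j
  · rw [mul_assoc, mul_left_comm]
    exact alphabets_z_y.X_u'_mul_X_v'_mul_mem_intertwined hf j i

/-- **Intertwining of the tilde projections with the shift operators**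
(relation (4.7f) of Chapuy–Dołęga): `Θ_Z̃ Ỹ_+ = Y_+ Θ_Z̃` and `Θ_Ỹ Z̃_+ = Z_+ Θ_Ỹ`
on `𝒫_{Ỹ,Z̃}`. -/
theorem Theta_tilde_intertwines_shifts :
    ∀ f ∈ PYZt,
      (ThZt (Ytplus f) = Plus Var.y (ThZt f)) ∧
      (ThYt (Ztplus f) = Plus Var.z (ThYt f)) := by
  intro f hf
  constructor
  · have h := PYZt_le_intertwined_y_z hf
    simp only [Alphabets.mem_intertwined, Alphabets.projTilde_apply] at h
    exact h
  · have h := PYZt_le_intertwined_z_y hf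
    simp only [Alphabets.mem_intertwined, Alphabets.projTilde_apply] at h
    exact h
end
end

section
/- Symmetrized commutation identity: for all integers m, n ≥ 0 and every f ∈ 𝒫_{Ỹ,Z̃}, [Z̃_+Λ_Z̃^{m+1}, Ỹ_+Λ_Ỹ^{n}] f + [Z̃_+Λ_Z̃^{n+1}, Ỹ_+Λ_Ỹ^{m}] f = Ỹ_+( Λ_Ỹ^{n}( Z̃_+( Λ_Z̃^{m}( Δ f ) ) ) ) + Ỹ_+( Λ_Ỹ^{m}( Z̃_+( Λ_Z̃^{n}( Δ f ) ) ) ), where [P,Q] f := P(Q f) − Q(P f). -/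
open MvPolynomial

noncomputable section

/-- `Z̃_+ Λ_Z̃^m`. -/
def ZL (m : ℕ) (f : R) : R := Ztplus (LamZt^[m] f)

/-- `Ỹ_+ Λ_Ỹ^n`. -/
def YL (n : ℕ) (f : R) : R := Ytplus (LamYt^[n] f)

section RingIdentity

variable {E : Type*} [Ring E] {A B D P Q : E}

lemma add_pow_sum_eq (hAD : A * D = D * B) (hBD : B * D = D * A)
    (hAB : A * B - B * A = B * D - A * D) (k : ℕ) :
    (A + D) ^ k + B ^ k = A ^ k + (B + D) ^ k := by
  have hs : A * B + A * D = B * A + B * D := by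
    rw [sub_eq_sub_iff_add_eq_add] at hAB; rw [hAB, add_comm]
  have h1 : (A + D) * B = A * (B + D) := by rw [add_mul, mul_add, hAD]
  have h2 : B * (A + D) = A * (B + D) := by
    rw [mul_add, mul_add, hs]
  have h3 : (B + D) * A = A * (B + D) := by
    rw [add_mul, mul_add, ← hBD, hs]
  induction k using Nat.twoStepInduction with
  | zero => simp
  | one => simp only [pow_one]; abel
  | more k ih0 ih1 =>
    have e1 : (A + D) ^ (k + 2) + B ^ (k + 2) =
        (A + B + D) * ((A + D) ^ (k + 1) + B ^ (k + 1))
          - A * (B + D) * ((A + D) ^ k + B ^ k) := by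
      have : A * (B + D) * ((A + D) ^ k + B ^ k)
          = B * (A + D) * (A + D) ^ k + (A + D) * B * B ^ k := by rw [h1, h2, mul_add]
      rw [this]; simp only [pow_succ']; noncomm_ring
    have e2 : A ^ (k + 2) + (B + D) ^ (k + 2) =
        (A + B + D) * (A ^ (k + 1) + (B + D) ^ (k + 1))
          - A * (B + D) * (A ^ k + (B + D) ^ k) := by
      have : A * (B + D) * (A ^ k + (B + D) ^ k)
          = (B + D) * A * A ^ k + A * (B + D) * (B + D) ^ k := by rw [h3, mul_add]
      rw [this]; simp only [pow_succ']; noncomm_ring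
    rw [e1, e2, ih0, ih1]

/-- The case `m = n + k` of the reduced symmetrized identity. -/
lemma reduced_symmetrized_aux (hAD : A * D = D * B) (hBD : B * D = D * A)
    (hAB : A * B - B * A = B * D - A * D) (n k : ℕ) :
    (A + D) ^ (n + k + 1) * B ^ n + (A + D) ^ (n + 1) * B ^ (n + k) =
      (B + D) ^ n * A ^ (n + k) * (A + D) + (B + D) ^ (n + k) * A ^ n * (A + D) := by
  have hs : A * B + A * D = B * A + B * D := by
    rw [sub_eq_sub_iff_add_eq_add] at hAB; rw [hAB, add_comm]
  have h1 : Commute (A + D) B := by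
    rw [Commute, SemiconjBy, add_mul, mul_add, ← hAD, hs]
  have h2 : Commute (B + D) A := by
    rw [Commute, SemiconjBy, add_mul, mul_add, ← hBD, hs]
  have h3 : (B + D) * A = (A + D) * B := by
    rw [add_mul, add_mul, ← hAD, ← hBD, hs]
  have h4 : (B + D) ^ n * A ^ n = (A + D) ^ n * B ^ n := by
    rw [← h2.mul_pow, ← h1.mul_pow, h3]
  have h5 := add_pow_sum_eq hAD hBD hAB k
  have l1 : (A + D) ^ (n + k + 1) * B ^ n = (A + D) ^ n * B ^ n * ((A + D) ^ k * (A + D)) := by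
    rw [← pow_succ, mul_assoc, ← (h1.pow_pow (k + 1) n).eq, ← mul_assoc, ← pow_add, add_assoc]
  have l2 : (A + D) ^ (n + 1) * B ^ (n + k) = (A + D) ^ n * B ^ n * (B ^ k * (A + D)) := by
    rw [← (h1.pow_right k).eq, pow_succ, mul_assoc, mul_assoc, pow_add,
      ← mul_assoc (A + D), (h1.pow_right n).eq]
    simp only [mul_assoc]
  have l3 : (B + D) ^ n * A ^ (n + k) * (A + D) =
      (A + D) ^ n * B ^ n * (A ^ k * (A + D)) := by
    rw [← h4, pow_add]; simp only [mul_assoc]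
  have l4 : (B + D) ^ (n + k) * A ^ n * (A + D) =
      (A + D) ^ n * B ^ n * ((B + D) ^ k * (A + D)) := by
    rw [← h4, pow_add, mul_assoc ((B + D) ^ n), (h2.pow_pow k n).eq]; simp only [mul_assoc]
  rw [l1, l2, l3, l4, ← mul_add, ← mul_add, ← add_mul, ← add_mul, h5]

lemma reduced_symmetrized (hAD : A * D = D * B) (hBD : B * D = D * A)
    (hAB : A * B - B * A = B * D - A * D) (m n : ℕ) :
    (A + D) ^ (m + 1) * B ^ n + (A + D) ^ (n + 1) * B ^ m =
      (B + D) ^ n * A ^ m * (A + D) + (B + D) ^ m * A ^ n * (A + D) := by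
  rcases le_total n m with h | h
  · obtain ⟨k, rfl⟩ := Nat.exists_eq_add_of_le h
    exact reduced_symmetrized_aux hAD hBD hAB n k
  · obtain ⟨k, rfl⟩ := Nat.exists_eq_add_of_le h
    rw [add_comm, reduced_symmetrized_aux hAD hBD hAB m k, add_comm]

/-- The symmetrized commutation identity, for elements of an arbitrary ring. -/
theorem symmetrized_commutation_of_relations (hAQ : A * Q = Q * (A + D))
    (hBP : B * P = P * (B + D)) (hPQ : P * Q = Q * P)
    (hAD : A * D = D * B) (hBD : B * D = D * A)
    (hAB : A * B - B * A = B * D - A * D) (m n : ℕ) :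
    (P * A ^ (m + 1) * (Q * B ^ n) - Q * B ^ n * (P * A ^ (m + 1)))
        + (P * A ^ (n + 1) * (Q * B ^ m) - Q * B ^ m * (P * A ^ (n + 1)))
      = Q * B ^ n * (P * A ^ m * D) + Q * B ^ m * (P * A ^ n * D) := by
  have hA (k : ℕ) : A ^ k * Q = Q * (A + D) ^ k :=
    (SemiconjBy.pow_right (show SemiconjBy Q (A + D) A from hAQ.symm) k).eq.symm
  have hB (k : ℕ) : B ^ k * P = P * (B + D) ^ k :=
    (SemiconjBy.pow_right (show SemiconjBy P (B + D) B from hBP.symm) k).eq.symm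
  have key (k l : ℕ) : P * A ^ (k + 1) * (Q * B ^ l) - Q * B ^ l * (P * A ^ (k + 1))
      - Q * B ^ l * (P * A ^ k * D)
      = P * Q * ((A + D) ^ (k + 1) * B ^ l - (B + D) ^ l * A ^ k * (A + D)) := by
    have e1 : P * A ^ (k + 1) * (Q * B ^ l) = P * Q * ((A + D) ^ (k + 1) * B ^ l) := by
      rw [mul_assoc, ← mul_assoc (A ^ _), hA]; simp only [mul_assoc]
    have e2 (X : E) : Q * B ^ l * (P * X) = P * Q * ((B + D) ^ l * X) := by
      rw [mul_assoc, ← mul_assoc (B ^ _), hB, hPQ]; simp only [mul_assoc]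
    rw [e1, mul_assoc P (A ^ k) D, e2, e2, pow_succ A]
    noncomm_ring
  have h := reduced_symmetrized hAD hBD hAB m n
  rw [← sub_eq_zero]
  calc _ = P * Q * ((A + D) ^ (m + 1) * B ^ n - (B + D) ^ n * A ^ m * (A + D))
        + P * Q * ((A + D) ^ (n + 1) * B ^ m - (B + D) ^ m * A ^ n * (A + D)) := by
        rw [← key, ← key]; abel
    _ = 0 := by
      rw [← mul_add, sub_add_sub_comm, h, sub_self, mul_zero]

end RingIdentity

section Model

/-- Polynomials in the `p`-variables. -/
abbrev PPoly : Type := MvPolynomial ℕ K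

/-- The two-particle space, with basis `u^a v^c` over the polynomials in the `p`-variables. -/
abbrev TwoPart : Type := ℕ × ℕ →₀ PPoly

/-- The element `f u^a v^c`. -/
def elt (a c : ℕ) (f : PPoly) : TwoPart := Finsupp.single (a, c) f

lemma smul_elt (a c : ℕ) (g f : PPoly) : g • elt a c f = elt a c (g * f) :=
  Finsupp.smul_single _ _ _

/-- `elt` as a linear map. -/
def eltL (a c : ℕ) : PPoly →ₗ[K] TwoPart := Finsupp.lsingle (a, c)

@[simp] lemma eltL_apply (a c : ℕ) (f : PPoly) : eltL a c f = elt a c f := rfl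

/-- The linear endomorphism with prescribed values on the `f u^a v^c`. -/
def ofElt (φ : ℕ → ℕ → PPoly →ₗ[K] TwoPart) : Module.End K TwoPart :=
  Finsupp.lsum K fun ac => φ ac.1 ac.2

lemma ofElt_elt (φ : ℕ → ℕ → PPoly →ₗ[K] TwoPart) (a c : ℕ) (f : PPoly) :
    ofElt φ (elt a c f) = φ a c f := Finsupp.lsum_single _ _ _ _

lemma end_ext {F G : Module.End K TwoPart} (h : ∀ a c f, F (elt a c f) = G (elt a c f)) :
    F = G := Finsupp.lhom_ext fun ac f => h ac.1 ac.2 f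

/-- Multiplication by `u`. -/
def mulU : Module.End K TwoPart := ofElt fun a c => eltL (a + 1) c

/-- Multiplication by `v`. -/
def mulV : Module.End K TwoPart := ofElt fun a c => eltL a (c + 1)

/-- The exchange of `u` and `v`. -/
def swapUV : Module.End K TwoPart := ofElt fun a c => eltL c a

/-- The operator `u ∂/∂u`. -/
def eulU : Module.End K TwoPart := ofElt fun a c => (a : K) • eltL a c

/-- The operator `v ∂/∂v`. -/
def eulV : Module.End K TwoPart := ofElt fun a c => (c : K) • eltL a c

/-- The polynomial part of multiplication by `∑_{j ≥ 1} p_j u^{-j}`. -/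
def lowU : Module.End K TwoPart := ofElt fun a c =>
  ∑ k ∈ Finset.range a, eltL k c ∘ₗ LinearMap.mulLeft K (X (a - k))

/-- The polynomial part of multiplication by `∑_{j ≥ 1} p_j v^{-j}`. -/
def lowV : Module.End K TwoPart := ofElt fun a c =>
  ∑ k ∈ Finset.range c, eltL a k ∘ₗ LinearMap.mulLeft K (X (c - k))

/-- The operator `∑_{i ≥ 1} i u^i ∂/∂p_i`. -/
def raiseU : Module.End K TwoPart := ofElt fun a c =>
  (mkDerivation K fun i : ℕ => (i : K) • elt (a + i) c 1 :
    Derivation K PPoly TwoPart).toLinearMap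

/-- The operator `∑_{i ≥ 1} i v^i ∂/∂p_i`. -/
def raiseV : Module.End K TwoPart := ofElt fun a c =>
  (mkDerivation K fun i : ℕ => (i : K) • elt a (c + i) 1 :
    Derivation K PPoly TwoPart).toLinearMap

/-- The operator `g ↦ v (g(v,v) - g(v,u)) / (v - u)`. -/
def divY : Module.End K TwoPart := ofElt fun a c =>
  ∑ k ∈ Finset.range c, eltL k (a + c - k)

/-- The operator `g ↦ u (g(u,u) - g(v,u)) / (u - v)`. -/
def divZ : Module.End K TwoPart := ofElt fun a c =>
  ∑ k ∈ Finset.range a, eltL (a + c - k) k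

section Apply

variable (a c : ℕ) (f : PPoly)

lemma mulU_elt : mulU (elt a c f) = elt (a + 1) c f := ofElt_elt _ _ _ _

lemma mulV_elt : mulV (elt a c f) = elt a (c + 1) f := ofElt_elt _ _ _ _

lemma swapUV_elt : swapUV (elt a c f) = elt c a f := ofElt_elt _ _ _ _

lemma eulU_elt : eulU (elt a c f) = (a : K) • elt a c f := ofElt_elt _ _ _ _

lemma eulV_elt : eulV (elt a c f) = (c : K) • elt a c f := ofElt_elt _ _ _ _

lemma lowU_elt : lowU (elt a c f) = ∑ k ∈ Finset.range a, elt k c (X (a - k) * f) := by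
  simp [lowU, ofElt_elt]

lemma lowV_elt : lowV (elt a c f) = ∑ k ∈ Finset.range c, elt a k (X (c - k) * f) := by
  simp [lowV, ofElt_elt]

lemma divY_elt : divY (elt a c f) = ∑ k ∈ Finset.range c, elt k (a + c - k) f := by
  simp [divY, ofElt_elt]

lemma divZ_elt : divZ (elt a c f) = ∑ k ∈ Finset.range a, elt (a + c - k) k f := by
  simp [divZ, ofElt_elt]

lemma raiseU_elt_X_mul (m : ℕ) : raiseU (elt a c (X m * f)) =
    (X m : PPoly) • raiseU (elt a c f) + (m : K) • elt (a + m) c f := by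
  simp only [raiseU, ofElt_elt, Derivation.coeFn_coe, Derivation.leibniz, mkDerivation_X]
  rw [smul_comm, smul_elt, mul_one]

lemma raiseV_elt_X_mul (m : ℕ) : raiseV (elt a c (X m * f)) =
    (X m : PPoly) • raiseV (elt a c f) + (m : K) • elt a (c + m) f := by
  simp only [raiseV, ofElt_elt, Derivation.coeFn_coe, Derivation.leibniz, mkDerivation_X]
  rw [smul_comm, smul_elt, mul_one]

end Apply

lemma pderiv_pderiv_comm {σ : Type*} (i j : σ) (f : MvPolynomial σ K) :
    pderiv i (pderiv j f) = pderiv j (pderiv i f) := by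
  classical
  have h : ⁅pderiv (R := K) i, pderiv (R := K) j⁆ = 0 := by
    refine derivation_ext fun k => ?_
    rw [Derivation.commutator_apply]
    simp only [pderiv_X, Pi.single_apply, Derivation.coe_zero, Pi.zero_apply]
    split_ifs <;> simp
  rw [← sub_eq_zero, ← Derivation.commutator_apply, h, Derivation.coe_zero, Pi.zero_apply]

lemma exists_pderiv_eq_zero (f : PPoly) : ∃ N, ∀ i, N ≤ i → pderiv i f = 0 :=
  ⟨f.vars.sup id + 1, fun i hi => pderiv_eq_zero_of_notMem_vars fun h => by
    have := Finset.le_sup (f := id) h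
    simp only [id] at this
    omega⟩

lemma mkDerivation_eq_sum {M : Type*} [AddCommGroup M] [Module K M] [Module PPoly M]
    [IsScalarTower K PPoly M] (w : ℕ → M) {f : PPoly} {N : ℕ}
    (hN : ∀ i, N ≤ i → pderiv i f = 0) :
    mkDerivation K w f = ∑ i ∈ Finset.range N, pderiv i f • w i := by
  let n := max N (f.vars.sup id + 1)
  let G : Derivation K PPoly M :=
    ∑ i ∈ Finset.range n, (LinearMap.toSpanSingleton PPoly M (w i)).compDer (pderiv i)
  have hG (g : PPoly) : G g = ∑ i ∈ Finset.range n, pderiv i g • w i := by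
    simp only [G, ← Derivation.coeFnAddMonoidHom_apply, map_sum, Finset.sum_apply]
    rfl
  have h1 : mkDerivation K w f = G f := by
    refine derivation_eq_of_forall_mem_vars fun j hj => ?_
    have hjn : j < n := by
      have := Finset.le_sup (f := id) hj
      simp only [id] at this
      omega
    rw [hG, mkDerivation_X, Finset.sum_eq_single_of_mem j (Finset.mem_range.2 hjn)]
    · simp
    · intro i _ hij
      rw [pderiv_X_of_ne hij.symm, zero_smul]
  rw [h1, hG]
  refine (Finset.sum_subset (Finset.range_mono (le_max_left _ _)) fun i _ hi => ?_).symm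
  rw [hN i (by simpa using hi), zero_smul]

lemma raiseU_elt (a c : ℕ) {f : PPoly} {N : ℕ} (hN : ∀ i, N ≤ i → pderiv i f = 0) :
    raiseU (elt a c f) =
      ∑ i ∈ Finset.range N, (i : K) • elt (a + i) c (pderiv i f) := by
  simp only [raiseU, ofElt_elt, Derivation.coeFn_coe]
  rw [mkDerivation_eq_sum _ hN]
  refine Finset.sum_congr rfl fun i _ => ?_
  rw [smul_comm, smul_elt, mul_one]

lemma raiseV_elt (a c : ℕ) {f : PPoly} {N : ℕ} (hN : ∀ i, N ≤ i → pderiv i f = 0) :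
    raiseV (elt a c f) =
      ∑ i ∈ Finset.range N, (i : K) • elt a (c + i) (pderiv i f) := by
  simp only [raiseV, ofElt_elt, Derivation.coeFn_coe]
  rw [mkDerivation_eq_sum _ hN]
  refine Finset.sum_congr rfl fun i _ => ?_
  rw [smul_comm, smul_elt, mul_one]

end Model

section SumLemmas

variable {M : Type*} [AddCommGroup M]

lemma sum_range_eq_sum_ite {c n : ℕ} (h : c ≤ n) (g : ℕ → M) :
    ∑ k ∈ Finset.range c, g k = ∑ k ∈ Finset.range n, if k < c then g k else 0 := by
  rw [← Finset.sum_filter]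
  congr 1; ext k; simp; omega

lemma eq_sum_ite {j n : ℕ} (h : j < n) (g : ℕ → M) :
    g j = ∑ k ∈ Finset.range n, if k = j then g k else 0 := by
  simp [h]

lemma sum_range_reflect_eq_sum_ite {a s n : ℕ} (h : a ≤ s) (hn : s < n) (g : ℕ → ℕ → M) :
    ∑ k ∈ Finset.range a, g (s - k) k =
      ∑ k ∈ Finset.range n, if s < a + k ∧ k ≤ s then g k (s - k) else 0 := by
  rw [← Finset.sum_filter]
  refine Finset.sum_nbij' (fun k => s - k) (fun k => s - k) ?_ ?_ ?_ ?_ ?_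
  · intro k hk; simp at hk ⊢; omega
  · intro k hk; simp at hk ⊢; omega
  · intro k hk; simp at hk ⊢; omega
  · intro k hk; simp at hk ⊢; omega
  · intro k hk
    simp only [Finset.mem_range] at hk
    rw [show s - (s - k) = k by omega]

lemma sum_shift_identity (a c i : ℕ) (g : ℕ → ℕ → M) :
    ∑ k ∈ Finset.range c, g k (a + c - k + i) - ∑ k ∈ Finset.range (c + i), g k (a + (c + i) - k)
      + (∑ k ∈ Finset.range (a + i), g (a + i + c - k) k
        - ∑ k ∈ Finset.range a, g (a + c - k + i) k) = g (c + i) a - g c (a + i) := by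
  have e1 : ∑ k ∈ Finset.range c, g k (a + c - k + i)
      = ∑ k ∈ Finset.range c, g k (a + c + i - k) :=
    Finset.sum_congr rfl fun k hk => by
      rw [Finset.mem_range] at hk; congr 1; omega
  have e2 : ∑ k ∈ Finset.range a, g (a + c - k + i) k
      = ∑ k ∈ Finset.range a, g (a + c + i - k) k :=
    Finset.sum_congr rfl fun k hk => by
      rw [Finset.mem_range] at hk; congr 1; omega
  have e3 : g (c + i) a = g (c + i) (a + c + i - (c + i)) := by congr 1; omega
  have e4 : g c (a + i) = g c (a + c + i - c) := by congr 1; omega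
  rw [e1, e2, e3, e4, show a + (c + i) = a + c + i by ring, show a + i + c = a + c + i by ring,
    sum_range_reflect_eq_sum_ite (a := a + i) (n := a + c + i + 1) (by omega) (by omega),
    sum_range_reflect_eq_sum_ite (a := a) (n := a + c + i + 1) (by omega) (by omega),
    sum_range_eq_sum_ite (c := c) (n := a + c + i + 1) (by omega),
    sum_range_eq_sum_ite (c := c + i) (n := a + c + i + 1) (by omega),
    eq_sum_ite (j := c + i) (n := a + c + i + 1) (by omega) fun k => g k (a + c + i - k),
    eq_sum_ite (j := c) (n := a + c + i + 1) (by omega) fun k => g k (a + c + i - k)]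
  simp only [← Finset.sum_sub_distrib, ← Finset.sum_add_distrib]
  refine Finset.sum_congr rfl fun k hk => ?_
  rw [Finset.mem_range] at hk
  split_ifs <;> first | omega | simp

lemma sum_triangle (c : ℕ) [Module K M] (g : ℕ → M) :
    ∑ k ∈ Finset.range c, ∑ l ∈ Finset.range k, g l =
      ∑ l ∈ Finset.range c, ((c : K) - 1 - l) • g l := by
  induction c with
  | zero => simp
  | succ c ih =>
    rw [Finset.sum_range_succ, ih, ← Finset.sum_add_distrib, Finset.sum_range_succ]
    push_cast
    rw [show ((c : K) + 1 - 1 - c) = 0 by ring, zero_smul, add_zero]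
    exact Finset.sum_congr rfl fun l _ => by
      rw [show (c : K) + 1 - 1 - l = (c - 1 - l) + 1 by ring, add_smul, one_smul]

lemma sum_triangle_shift {a c n : ℕ} (h : a + c ≤ n) (g : ℕ → ℕ → M) :
    ∑ k ∈ Finset.range c, ∑ l ∈ Finset.range k, g l (a + k - l) =
      ∑ l ∈ Finset.range n, ∑ j ∈ Finset.range n,
        if l < c ∧ a < j ∧ l + j < a + c then g l j else 0 := by
  rw [← Finset.sum_product', ← Finset.sum_filter, Finset.sum_sigma']
  refine Finset.sum_nbij' (fun x => (x.2, a + x.1 - x.2)) (fun x => ⟨x.1 + x.2 - a, x.1⟩)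
    ?_ ?_ ?_ ?_ ?_
  · rintro ⟨k, l⟩ hk; simp at hk ⊢; omega
  · rintro ⟨k, l⟩ hk; simp at hk ⊢; omega
  · rintro ⟨k, l⟩ hk; simp at hk ⊢; omega
  · rintro ⟨k, l⟩ hk; simp at hk ⊢; omega
  · rintro ⟨k, l⟩ _; rfl

end SumLemmas

section Relations

lemma swapUV_mul_swapUV : swapUV * swapUV = 1 :=
  end_ext fun a c f => by simp [swapUV_elt]

lemma swapUV_mul_mulV : swapUV * mulV = mulU * swapUV :=
  end_ext fun a c f => by simp [swapUV_elt, mulU_elt, mulV_elt]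

lemma mulV_mul_mulU : mulV * mulU = mulU * mulV :=
  end_ext fun a c f => by simp [mulU_elt, mulV_elt]

lemma swapUV_mul_raiseV : swapUV * raiseV = raiseU * swapUV :=
  end_ext fun a c f => by
    obtain ⟨N, hN⟩ := exists_pderiv_eq_zero f
    simp [swapUV_elt, raiseU_elt _ _ hN, raiseV_elt _ _ hN]

lemma swapUV_mul_lowV : swapUV * lowV = lowU * swapUV :=
  end_ext fun a c f => by simp [swapUV_elt, lowU_elt, lowV_elt]

lemma swapUV_mul_eulV : swapUV * eulV = eulU * swapUV :=
  end_ext fun a c f => by simp [swapUV_elt, eulU_elt, eulV_elt]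

lemma swapUV_mul_divZ : swapUV * divZ = divY * swapUV :=
  end_ext fun a c f => by simp [swapUV_elt, divZ_elt, divY_elt, add_comm]

lemma raiseV_mul_mulU : raiseV * mulU = mulU * raiseV :=
  end_ext fun a c f => by
    obtain ⟨N, hN⟩ := exists_pderiv_eq_zero f
    simp [mulU_elt, raiseV_elt _ _ hN]

lemma lowV_mul_mulU : lowV * mulU = mulU * lowV :=
  end_ext fun a c f => by simp [mulU_elt, lowV_elt]

lemma eulV_mul_mulU : eulV * mulU = mulU * eulV :=
  end_ext fun a c f => by simp [mulU_elt, eulV_elt]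

lemma divZ_mul_mulU : divZ * mulU = mulU * divZ + mulU * swapUV :=
  end_ext fun a c f => by
    simp only [Module.End.mul_apply, LinearMap.add_apply, mulU_elt, divZ_elt, swapUV_elt, map_sum,
      Finset.sum_range_succ]
    congr 1
    · refine Finset.sum_congr rfl fun k hk => ?_
      rw [Finset.mem_range] at hk
      congr 1; omega
    · congr 1; omega

lemma raise_div_relation :
    raiseV * divY - divY * raiseV + (divZ * raiseU - raiseU * divZ)
      = (raiseU - raiseV) * swapUV :=
  end_ext fun a c f => by
    obtain ⟨N, hN⟩ := exists_pderiv_eq_zero f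
    simp only [Module.End.mul_apply, LinearMap.add_apply, LinearMap.sub_apply, divY_elt, divZ_elt,
      swapUV_elt, map_sum, raiseU_elt _ _ hN, raiseV_elt _ _ hN, map_smul]
    rw [Finset.sum_comm, Finset.sum_comm (s := Finset.range a)]
    simp only [← Finset.sum_sub_distrib, ← Finset.sum_add_distrib]
    refine Finset.sum_congr rfl fun i _ => ?_
    rw [← Finset.smul_sum, ← Finset.smul_sum, ← smul_sub, ← smul_sub, ← smul_sub, ← smul_add,
      sum_shift_identity a c i fun k l => elt k l (pderiv i f)]

lemma low_div_relation :
    lowV * divY - divY * lowV + (divZ * lowU - lowU * divZ)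
      = (lowU - lowV) * swapUV :=
  end_ext fun a c f => by
    simp only [Module.End.mul_apply, LinearMap.add_apply, LinearMap.sub_apply, divY_elt, divZ_elt,
      swapUV_elt, map_sum, lowU_elt, lowV_elt]
    set g : ℕ → ℕ → TwoPart := fun k l => elt k l (X (a + c - (k + l)) * f) with hg
    have e1 : ∑ k ∈ Finset.range c, ∑ l ∈ Finset.range (a + c - k),
        elt k l (X (a + c - k - l) * f) = ∑ k ∈ Finset.range (a + c), ∑ l ∈ Finset.range (a + c),
          if k < c ∧ k + l < a + c then g k l else 0 := by
      rw [sum_range_eq_sum_ite (c := c) (n := a + c) (by omega)]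
      refine Finset.sum_congr rfl fun k _ => ?_
      split_ifs with hk
      · rw [sum_range_eq_sum_ite (c := a + c - k) (n := a + c) (by omega)]
        refine Finset.sum_congr rfl fun l _ => ?_
        simp only [hg, Nat.sub_sub]
        congr 1
        simp; omega
      · simp [hk]
    have e2 : ∑ k ∈ Finset.range c, ∑ l ∈ Finset.range k,
        elt l (a + k - l) (X (c - k) * f) = ∑ k ∈ Finset.range (a + c),
          ∑ l ∈ Finset.range (a + c),
            if k < c ∧ a < l ∧ k + l < a + c then g k l else 0 := by
      rw [← sum_triangle_shift le_rfl]
      refine Finset.sum_congr rfl fun k hk => Finset.sum_congr rfl fun l hl => ?_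
      simp only [Finset.mem_range] at hk hl
      simp only [hg]
      rw [show a + c - (l + (a + k - l)) = c - k by omega]
    have e3 : ∑ k ∈ Finset.range a, ∑ l ∈ Finset.range (a + c - k),
        elt l k (X (a + c - k - l) * f) = ∑ k ∈ Finset.range (a + c), ∑ l ∈ Finset.range (a + c),
          if l < a ∧ k + l < a + c then g k l else 0 := by
      rw [sum_range_eq_sum_ite (c := a) (n := a + c) (by omega), Finset.sum_comm]
      refine Finset.sum_congr rfl fun k _ => ?_
      split_ifs with hk
      · rw [sum_range_eq_sum_ite (c := a + c - k) (n := a + c) (by omega)]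
        refine Finset.sum_congr rfl fun l _ => ?_
        simp only [hg, Nat.sub_sub, add_comm k l]
        congr 1
        simp; omega
      · simp [hk]
    have e4 : ∑ k ∈ Finset.range a, ∑ l ∈ Finset.range k,
        elt (k + c - l) l (X (a - k) * f) = ∑ k ∈ Finset.range (a + c),
          ∑ l ∈ Finset.range (a + c),
            if l < a ∧ c < k ∧ k + l < a + c then g k l else 0 := by
      rw [Finset.sum_comm (s := Finset.range (a + c))]
      refine (Eq.trans ?_ (sum_triangle_shift (a := c) (c := a) (n := a + c) (by omega)
        fun k l => g l k)).trans <| Finset.sum_congr rfl fun k _ => Finset.sum_congr rfl fun l _ =>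
          if_congr (by omega) rfl rfl
      refine Finset.sum_congr rfl fun k hk => Finset.sum_congr rfl fun l hl => ?_
      simp only [Finset.mem_range] at hk hl
      simp only [hg]
      rw [show a + c - (c + k - l + l) = a - k by omega, add_comm k c]
    have e5 : ∑ k ∈ Finset.range c, elt k a (X (c - k) * f) = ∑ k ∈ Finset.range (a + c),
        ∑ l ∈ Finset.range (a + c), if k < c ∧ l = a ∧ k + l < a + c then g k l else 0 := by
      rw [sum_range_eq_sum_ite (c := c) (n := a + c) (by omega)]
      refine Finset.sum_congr rfl fun k hk => ?_
      split_ifs with hkc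
      · have ha : a < a + c := by omega
        rw [Finset.sum_eq_single_of_mem a (Finset.mem_range.2 ha)
          fun l _ hl => by simp [hl], if_pos ⟨hkc, rfl, by omega⟩]
        simp only [hg]
        rw [show a + c - (k + a) = c - k by omega]
      · simp [hkc]
    have e6 : ∑ k ∈ Finset.range a, elt c k (X (a - k) * f) = ∑ k ∈ Finset.range (a + c),
        ∑ l ∈ Finset.range (a + c), if l < a ∧ k = c ∧ k + l < a + c then g k l else 0 := by
      rw [sum_range_eq_sum_ite (c := a) (n := a + c) (by omega), Finset.sum_comm]
      refine Finset.sum_congr rfl fun l hl => ?_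
      split_ifs with hla
      · have hc : c < a + c := by omega
        rw [Finset.sum_eq_single_of_mem c (Finset.mem_range.2 hc)
          fun k _ hk => by simp [hk], if_pos ⟨hla, rfl, by omega⟩]
        simp only [hg]
        rw [show a + c - (c + l) = a - l by omega]
      · simp [hla]
    rw [e1, e2, e3, e4, e5, e6]
    simp only [← Finset.sum_sub_distrib, ← Finset.sum_add_distrib]
    refine Finset.sum_congr rfl fun k hk => Finset.sum_congr rfl fun l hl => ?_
    split_ifs <;> first | omega | simp

lemma divZ_divY_elt (a c : ℕ) (f : PPoly) : divZ (divY (elt a c f)) =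
    ∑ l ∈ Finset.range c, ((c : K) - 1 - l) • elt (a + c - l) l f := by
  rw [divY_elt, map_sum, ← sum_triangle]
  refine Finset.sum_congr rfl fun k hk => ?_
  rw [Finset.mem_range] at hk
  rw [divZ_elt, show k + (a + c - k) = a + c by omega]

lemma divY_divZ_elt (a c : ℕ) (f : PPoly) : divY (divZ (elt a c f)) =
    ∑ l ∈ Finset.range a, ((a : K) - 1 - l) • elt l (a + c - l) f := by
  rw [divZ_elt, map_sum, ← sum_triangle]
  refine Finset.sum_congr rfl fun k hk => ?_
  rw [Finset.mem_range] at hk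
  rw [divY_elt, show a + c - k + k = a + c by omega]

lemma raise_low_relation :
    raiseV * lowU - lowU * raiseV + (lowV * raiseU - raiseU * lowV)
      + (divZ * divY - divY * divZ) = (divY - divZ) * swapUV :=
  end_ext fun a c f => by
    obtain ⟨N, hN⟩ := exists_pderiv_eq_zero f
    have h1 : lowU (raiseV (elt a c f))
        = ∑ k ∈ Finset.range a, (X (a - k) : PPoly) • raiseV (elt k c f) := by
      simp only [raiseV_elt _ _ hN, map_sum, map_smul, lowU_elt, Finset.smul_sum]
      rw [Finset.sum_comm]
      refine Finset.sum_congr rfl fun k _ => Finset.sum_congr rfl fun i _ => ?_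
      rw [smul_comm, smul_elt]
    have h2 : lowV (raiseU (elt a c f))
        = ∑ k ∈ Finset.range c, (X (c - k) : PPoly) • raiseU (elt a k f) := by
      simp only [raiseU_elt _ _ hN, map_sum, map_smul, lowV_elt, Finset.smul_sum]
      rw [Finset.sum_comm]
      refine Finset.sum_congr rfl fun k _ => Finset.sum_congr rfl fun i _ => ?_
      rw [smul_comm, smul_elt]
    have h3 : raiseV (lowU (elt a c f))
        = ∑ k ∈ Finset.range a, (X (a - k) : PPoly) • raiseV (elt k c f)
          + (divY (divZ (elt a c f)) + divY (elt c a f)) := by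
      rw [divY_divZ_elt, divY_elt, ← Finset.sum_add_distrib, ← Finset.sum_add_distrib, lowU_elt,
        map_sum]
      refine Finset.sum_congr rfl fun k hk => ?_
      rw [Finset.mem_range] at hk
      rw [raiseV_elt_X_mul, Nat.cast_sub hk.le, show c + (a - k) = a + c - k by omega,
        add_comm c a]
      rw [show (a : K) - k = (a - 1 - k) + 1 by ring, add_smul, one_smul]
    have h4 : raiseU (lowV (elt a c f))
        = ∑ k ∈ Finset.range c, (X (c - k) : PPoly) • raiseU (elt a k f)
          + (divZ (divY (elt a c f)) + divZ (elt c a f)) := by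
      rw [divZ_divY_elt, divZ_elt, ← Finset.sum_add_distrib, ← Finset.sum_add_distrib, lowV_elt,
        map_sum]
      refine Finset.sum_congr rfl fun k hk => ?_
      rw [Finset.mem_range] at hk
      rw [raiseU_elt_X_mul, Nat.cast_sub hk.le, show a + (c - k) = a + c - k by omega,
        add_comm c a]
      rw [show (c : K) - k = (c - 1 - k) + 1 by ring, add_smul, one_smul]
    simp only [Module.End.mul_apply, LinearMap.add_apply, LinearMap.sub_apply, swapUV_elt]
    rw [h1, h2, h3, h4]
    abel

lemma eul_div_relation :
    eulV * divY - divY * eulV + (divZ * eulU - eulU * divZ) + (divZ * divY - divY * divZ)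
      = (eulU - eulV) * swapUV + (divY - divZ) * swapUV :=
  end_ext fun a c f => by
    have h1 : eulV (divY (elt a c f)) - divY (eulV (elt a c f)) =
        ∑ k ∈ Finset.range c, ((a : K) - k) • elt k (a + c - k) f := by
      rw [eulV_elt, map_smul, divY_elt, map_sum, Finset.smul_sum, ← Finset.sum_sub_distrib]
      refine Finset.sum_congr rfl fun k hk => ?_
      rw [Finset.mem_range] at hk
      rw [eulV_elt, Nat.cast_sub (by omega), Nat.cast_add]
      rw [← sub_smul]
      congr 1; ring
    have h2 : divZ (eulU (elt a c f)) - eulU (divZ (elt a c f)) =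
        ∑ k ∈ Finset.range a, ((k : K) - c) • elt (a + c - k) k f := by
      rw [eulU_elt, map_smul, divZ_elt, map_sum, Finset.smul_sum, ← Finset.sum_sub_distrib]
      refine Finset.sum_congr rfl fun k hk => ?_
      rw [Finset.mem_range] at hk
      rw [eulU_elt, Nat.cast_sub (by omega), Nat.cast_add]
      rw [← sub_smul]
      congr 1; ring
    have h3 : (c : K) • elt c a f - (a : K) • elt c a f =
        ∑ k ∈ Finset.range (a + c + 1),
          if k = c then ((c : K) - a) • elt k (a + c - k) f else 0 := by
      rw [← eq_sum_ite (j := c) (by omega) fun k => ((c : K) - a) • elt k (a + c - k) f, ← sub_smul,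
        show a + c - c = a by omega]
    simp only [Module.End.mul_apply, LinearMap.add_apply, LinearMap.sub_apply, swapUV_elt,
      eulU_elt c a, eulV_elt c a]
    rw [h1, h2, h3, divZ_divY_elt, divY_divZ_elt, divY_elt, divZ_elt, add_comm c a,
      sum_range_reflect_eq_sum_ite (a := a) (n := a + c + 1) (by omega) (by omega)
        fun i j => ((j : K) - c) • elt i j f,
      sum_range_reflect_eq_sum_ite (a := c) (n := a + c + 1) (by omega) (by omega)
        fun i j => ((c : K) - 1 - j) • elt i j f,
      sum_range_reflect_eq_sum_ite (a := c) (n := a + c + 1) (by omega) (by omega)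
        fun i j => elt i j f]
    simp only [sum_range_eq_sum_ite (show c ≤ a + c + 1 by omega),
      sum_range_eq_sum_ite (show a ≤ a + c + 1 by omega), ← Finset.sum_sub_distrib,
      ← Finset.sum_add_distrib]
    refine Finset.sum_congr rfl fun k hk => ?_
    rw [Finset.mem_range] at hk
    rw [Nat.cast_sub (by omega), Nat.cast_add]
    generalize elt k (a + c - k) f = x
    have hx (p : Prop) [Decidable p] : (if p then x else 0) = (if p then (1 : K) else 0) • x := by
      simp
    have hrx (r : K) (p : Prop) [Decidable p] :
        (if p then r • x else 0) = (if p then r else 0) • x := by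
      simp
    simp only [hx, hrx, ← sub_smul, ← add_smul]
    congr 1
    split_ifs
    all_goals first
      | omega
      | ring1
      | (obtain rfl : k = c := by omega
         ring1)
      | (obtain rfl : k = a := by omega
         ring1)
      | (obtain rfl : k = c := by omega
         obtain rfl : k = a := by omega
         ring1)

lemma commute_raiseV_raiseU : raiseV * raiseU = raiseU * raiseV :=
  end_ext fun a c f => by
    obtain ⟨N, hN⟩ := exists_pderiv_eq_zero f
    have hN' (j : ℕ) : ∀ i, N ≤ i → pderiv i (pderiv j f) = 0 := fun i hi => by
      rw [pderiv_pderiv_comm, hN i hi, map_zero]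
    simp only [Module.End.mul_apply, raiseU_elt _ _ hN, raiseV_elt _ _ hN, map_sum, map_smul,
      raiseU_elt _ _ (hN' _), raiseV_elt _ _ (hN' _), Finset.smul_sum]
    rw [Finset.sum_comm]
    refine Finset.sum_congr rfl fun i _ => Finset.sum_congr rfl fun j _ => ?_
    rw [pderiv_pderiv_comm, smul_comm]

lemma commute_lowV_lowU : lowV * lowU = lowU * lowV :=
  end_ext fun a c f => by
    simp only [Module.End.mul_apply, lowU_elt, lowV_elt, map_sum]
    rw [Finset.sum_comm]
    simp only [mul_left_comm]

lemma commute_eulV_eulU : eulV * eulU = eulU * eulV :=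
  end_ext fun a c f => by
    simp only [Module.End.mul_apply, eulU_elt, eulV_elt, map_smul, smul_comm (a : K)]

lemma commute_raiseV_eulU : raiseV * eulU = eulU * raiseV :=
  end_ext fun a c f => by
    obtain ⟨N, hN⟩ := exists_pderiv_eq_zero f
    simp only [Module.End.mul_apply, eulU_elt, raiseV_elt _ _ hN, map_smul, map_sum,
      Finset.smul_sum, smul_comm (a : K)]

lemma commute_eulV_raiseU : eulV * raiseU = raiseU * eulV :=
  end_ext fun a c f => by
    obtain ⟨N, hN⟩ := exists_pderiv_eq_zero f
    simp only [Module.End.mul_apply, eulV_elt, raiseU_elt _ _ hN, map_smul, map_sum,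
      Finset.smul_sum, smul_comm (c : K)]

lemma commute_lowV_eulU : lowV * eulU = eulU * lowV :=
  end_ext fun a c f => by
    simp only [Module.End.mul_apply, eulU_elt, lowV_elt, map_smul, map_sum, Finset.smul_sum]

lemma commute_eulV_lowU : eulV * lowU = lowU * eulV :=
  end_ext fun a c f => by
    simp only [Module.End.mul_apply, eulV_elt, lowU_elt, map_smul, map_sum, Finset.smul_sum]

end Relations

section Combination

/-- The model of `Λ_Z̃`, for `t` a root of `t² = b t + α`. -/
def lamZ (t : K) : Module.End K TwoPart := alpha • raiseV + lowV + bb • eulV + t • divZ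

/-- The model of `Λ_Ỹ`, for `t` a root of `t² = b t + α`. -/
def lamY (t : K) : Module.End K TwoPart := alpha • raiseU + lowU + bb • eulU + t • divY

lemma commutator_eq_of_relations {k E : Type*} [CommRing k] [Ring E] [Module k E]
    [IsScalarTower k E E] [SMulCommClass k E E]
    {α b t : k} (ht : α = t * t - b * t) {rV lV eV dZ rU lU eU dY S : E}
    (hrr : rV * rU = rU * rV) (hll : lV * lU = lU * lV) (hee : eV * eU = eU * eV)
    (hre : rV * eU = eU * rV) (her : eV * rU = rU * eV)
    (hle : lV * eU = eU * lV) (hel : eV * lU = lU * eV)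
    (hrl : rV * lU - lU * rV + (lV * rU - rU * lV) + (dZ * dY - dY * dZ) = (dY - dZ) * S)
    (hrd : rV * dY - dY * rV + (dZ * rU - rU * dZ) = (rU - rV) * S)
    (hld : lV * dY - dY * lV + (dZ * lU - lU * dZ) = (lU - lV) * S)
    (hed : eV * dY - dY * eV + (dZ * eU - eU * dZ) + (dZ * dY - dY * dZ)
      = (eU - eV) * S + (dY - dZ) * S) :
    (α • rV + lV + b • eV + t • dZ) * (α • rU + lU + b • eU + t • dY)
        - (α • rU + lU + b • eU + t • dY) * (α • rV + lV + b • eV + t • dZ)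
      = (α • rU + lU + b • eU + t • dY) * (t • S) - (α • rV + lV + b • eV + t • dZ) * (t • S) := by
  subst ht
  rw [sub_mul] at hrd hld hrl
  rw [sub_mul, sub_mul] at hed
  simp only [add_mul, mul_add, smul_mul_assoc, mul_smul_comm]
  linear_combination (norm := module) (t * t - b * t) ^ 2 • hrr + hll + b ^ 2 • hee
    + ((t * t - b * t) * b) • hre + ((t * t - b * t) * b) • her + b • hle + b • hel
    + (t * t - b * t) • hrl + ((t * t - b * t) * t) • hrd + t • hld + (b * t) • hed

lemma lamZ_mul_mulU (t : K) : lamZ t * mulU = mulU * (lamZ t + t • swapUV) := by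
  simp only [lamZ, add_mul, mul_add, smul_mul_assoc, mul_smul_comm, raiseV_mul_mulU,
    lowV_mul_mulU, eulV_mul_mulU, divZ_mul_mulU, smul_add]
  abel

lemma swapUV_mul_lamZ (t : K) : swapUV * lamZ t = lamY t * swapUV := by
  simp only [lamZ, lamY, add_mul, mul_add, smul_mul_assoc, mul_smul_comm, swapUV_mul_raiseV,
    swapUV_mul_lowV, swapUV_mul_eulV, swapUV_mul_divZ]

lemma swapUV_mul_symm {F G : Module.End K TwoPart} (h : swapUV * F = G * swapUV) :
    swapUV * G = F * swapUV := by
  have h := congrArg (fun F => swapUV * F * swapUV) h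
  simp only [mul_assoc, swapUV_mul_swapUV, mul_one] at h
  rw [← h, ← mul_assoc, swapUV_mul_swapUV, one_mul]

lemma swapUV_mul_lamY (t : K) : swapUV * lamY t = lamZ t * swapUV :=
  swapUV_mul_symm (swapUV_mul_lamZ t)

lemma swapUV_mul_mulU : swapUV * mulU = mulV * swapUV :=
  swapUV_mul_symm swapUV_mul_mulV

lemma lamY_mul_mulV (t : K) : lamY t * mulV = mulV * (lamY t + t • swapUV) := by
  have h := congrArg (fun F => swapUV * F * swapUV) (lamZ_mul_mulU t)
  simp only [mul_add, add_mul, mul_smul_comm, smul_mul_assoc] at h ⊢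
  simp only [← mul_assoc, swapUV_mul_lamZ, swapUV_mul_mulU] at h
  simp only [mul_assoc, swapUV_mul_lamZ, swapUV_mul_mulU, swapUV_mul_swapUV, mul_one] at h
  exact h

lemma lamZ_mul_lamY_sub {t : K} (ht : t * t = bb * t + alpha) :
    lamZ t * lamY t - lamY t * lamZ t = lamY t * (t • swapUV) - lamZ t * (t • swapUV) := by
  have ht' : alpha = t * t - bb * t := by rw [ht, add_sub_cancel_left]
  exact commutator_eq_of_relations (k := K) (E := Module.End K TwoPart) (α := alpha) (b := bb)
    (t := t) (rV := raiseV) (lV := lowV) (eV := eulV) (dZ := divZ) (rU := raiseU) (lU := lowU)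
    (eU := eulU) (dY := divY) (S := swapUV) ht' commute_raiseV_raiseU commute_lowV_lowU
    commute_eulV_eulU commute_raiseV_eulU commute_eulV_raiseU commute_lowV_eulU
    commute_eulV_lowU raise_low_relation raise_div_relation low_div_relation eul_div_relation

lemma symmetrized_commutation_model {t : K} (ht : t * t = bb * t + alpha) (m n : ℕ) :
    (mulV * lamZ t ^ (m + 1) * (mulU * lamY t ^ n) - mulU * lamY t ^ n * (mulV * lamZ t ^ (m + 1)))
      + (mulV * lamZ t ^ (n + 1) * (mulU * lamY t ^ m)
        - mulU * lamY t ^ m * (mulV * lamZ t ^ (n + 1)))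
      = mulU * lamY t ^ n * (mulV * lamZ t ^ m * (t • swapUV))
        + mulU * lamY t ^ m * (mulV * lamZ t ^ n * (t • swapUV)) :=
  symmetrized_commutation_of_relations (D := t • swapUV) (lamZ_mul_mulU t) (lamY_mul_mulV t)
    mulV_mul_mulU
    (by rw [mul_smul_comm t (lamZ t) swapUV, smul_mul_assoc t swapUV, swapUV_mul_lamY])
    (by rw [mul_smul_comm t (lamY t) swapUV, smul_mul_assoc t swapUV, swapUV_mul_lamZ])
    (lamZ_mul_lamY_sub ht) m n

end Combination

section Locality

lemma finsum_eq_sum_range {M : Type*} [AddCommMonoid M] {g : ℕ → M} {N : ℕ}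
    (h : ∀ i, N ≤ i → g i = 0) : ∑ᶠ i, g i = ∑ i ∈ Finset.range N, g i :=
  finsum_eq_sum_of_support_subset _ fun i hi => by
    by_contra hiN
    exact hi (h i (by simpa using hiN))

lemma isLinearMap_finsum {G : ℕ → R → R} (hG : ∀ i, IsLinearMap K (G i))
    (h : ∀ f, ∃ N, ∀ i, N ≤ i → G i f = 0) : IsLinearMap K fun f => ∑ᶠ i, G i f where
  map_add f g := by
    obtain ⟨N, hN⟩ := h f
    obtain ⟨N', hN'⟩ := h g
    have hf : ∀ i, max N N' ≤ i → G i f = 0 := fun i hi => hN i (le_trans (le_max_left _ _) hi)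
    have hg : ∀ i, max N N' ≤ i → G i g = 0 := fun i hi => hN' i (le_trans (le_max_right _ _) hi)
    rw [finsum_eq_sum_range hf, finsum_eq_sum_range hg, finsum_eq_sum_range (N := max N N'),
      ← Finset.sum_add_distrib]
    · exact Finset.sum_congr rfl fun i _ => (hG i).map_add f g
    · intro i hi
      rw [(hG i).map_add, hf i hi, hg i hi, add_zero]
  map_smul r f := by
    obtain ⟨N, hN⟩ := h f
    rw [finsum_eq_sum_range hN, finsum_eq_sum_range (N := N), Finset.smul_sum]
    · exact Finset.sum_congr rfl fun i _ => (hG i).map_smul r f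
    · intro i hi
      rw [(hG i).map_smul, hN i hi, smul_zero]

lemma exists_pderiv_letter_eq_zero {l : ℕ → Var} (hl : l.Injective) (f : R) :
    ∃ N, ∀ i, N ≤ i → pderiv (l i) f = 0 := by
  obtain ⟨N, hN⟩ := (f.vars.finite_toSet.preimage hl.injOn).bddAbove
  refine ⟨N + 1, fun i hi => pderiv_eq_zero_of_notMem_vars fun h => ?_⟩
  have := hN (show i ∈ l ⁻¹' _ from h)
  omega

/-- The operator `∑ r1_{i+j+1} r2_k ∂²/∂l1_{i+k+1}∂l2_j`. -/
def triSum (r1 r2 l1 l2 : ℕ → Var) (f : R) : R :=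
  ∑ᶠ (i : ℕ) (j : ℕ) (k : ℕ), X (r1 (i + j + 1)) * X (r2 k) *
    pderiv (l1 (i + k + 1)) (pderiv (l2 j) f)

/-- The operator `∑ r1_i r2_j ∂²/∂l1_i∂l2_j`. -/
def biSum (r1 r2 l1 l2 : ℕ → Var) (f : R) : R :=
  ∑ᶠ (i : ℕ) (j : ℕ), X (r1 i) * X (r2 j) * pderiv (l1 i) (pderiv (l2 j) f)

/-- The operator `∑ (i + 1) a_{i+j+1} ∂²/∂p_{i+1}∂a_j`. -/
def raiseSum (a : ℕ → Var) (f : R) : R :=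
  ∑ᶠ (i : ℕ) (j : ℕ), ((i + 1 : ℕ) : K) •
    (X (a (i + j + 1)) * pderiv (Var.p (i + 1)) (pderiv (a j) f))

/-- The operator `∑ a_i p_{j+1} ∂/∂a_{i+j+1}`. -/
def lowSum (a : ℕ → Var) (f : R) : R :=
  ∑ᶠ (i : ℕ) (j : ℕ), X (a i) * X (Var.p (j + 1)) * pderiv (a (i + j + 1)) f

/-- The operator `∑ (i + 1) a_{i+1} ∂/∂a_{i+1}`. -/
def eulSum (a : ℕ → Var) (f : R) : R :=
  ∑ᶠ (i : ℕ), ((i + 1 : ℕ) : K) • (X (a (i + 1)) * pderiv (a (i + 1)) f)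

lemma Lam_eq (a : ℕ → Var) (f : R) :
    Lam a f = alpha • raiseSum a f + lowSum a f + bb • eulSum a f := rfl

lemma MZ_eq (f : R) : MZ f = alpha • triSum Var.y' Var.z' Var.y Var.z f
    + triSum Var.y Var.z Var.y' Var.z' f + bb • triSum Var.y' Var.z' Var.y' Var.z' f := rfl

lemma MY_eq (f : R) : MY f = alpha • triSum Var.z' Var.y' Var.z Var.y f
    + triSum Var.z Var.y Var.z' Var.y' f + bb • triSum Var.z' Var.y' Var.z' Var.y' f := rfl

lemma Delta_eq (f : R) : Delta f = alpha • biSum Var.z' Var.y' Var.y Var.z f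
    + biSum Var.z Var.y Var.y' Var.z' f + bb • biSum Var.z' Var.y' Var.y' Var.z' f := rfl

lemma isLinearMap_mul_pderiv (x : R) (v : Var) : IsLinearMap K fun f => x * pderiv v f :=
  ((LinearMap.mulLeft K x) ∘ₗ (pderiv v).toLinearMap).isLinear

lemma isLinearMap_mul_pderiv_pderiv (x : R) (v w : Var) :
    IsLinearMap K fun f => x * pderiv v (pderiv w f) :=
  ((LinearMap.mulLeft K x) ∘ₗ (pderiv v).toLinearMap ∘ₗ (pderiv w).toLinearMap).isLinear

lemma IsLinearMap.const_smul {G : R → R} (hG : IsLinearMap K G) (r : K) :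
    IsLinearMap K fun f => r • G f :=
  (r • hG.mk' G).isLinear

lemma IsLinearMap.add_fun {G H : R → R} (hG : IsLinearMap K G) (hH : IsLinearMap K H) :
    IsLinearMap K fun f => G f + H f :=
  (hG.mk' G + hH.mk' H).isLinear

lemma isLinearMap_comp {G H : R → R} (hG : IsLinearMap K G) (hH : IsLinearMap K H) :
    IsLinearMap K (G ∘ H) :=
  (hG.mk' G ∘ₗ hH.mk' H).isLinear

lemma isLinearMap_iterate {G : R → R} (hG : IsLinearMap K G) (n : ℕ) :
    IsLinearMap K G^[n] := by
  induction n with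
  | zero => exact LinearMap.id.isLinear
  | succ n ih =>
    rw [Function.iterate_succ]
    exact isLinearMap_comp ih hG

section Letters

variable {l l1 l2 : ℕ → Var} (hl : l.Injective) (hl1 : l1.Injective) (hl2 : l2.Injective)
include hl

lemma isLinearMap_Plus : IsLinearMap K (Plus l) := by
  refine isLinearMap_finsum (fun i => isLinearMap_mul_pderiv _ _) fun f => ?_
  obtain ⟨N, hN⟩ := exists_pderiv_letter_eq_zero hl f
  exact ⟨N, fun i hi => by rw [hN i hi, mul_zero]⟩

lemma isLinearMap_eulSum : IsLinearMap K (eulSum l) := by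
  refine isLinearMap_finsum (fun i => (isLinearMap_mul_pderiv _ _).const_smul _) fun f => ?_
  obtain ⟨N, hN⟩ := exists_pderiv_letter_eq_zero hl f
  exact ⟨N, fun i hi => by rw [hN (i + 1) (by omega), mul_zero, smul_zero]⟩

lemma isLinearMap_lowSum : IsLinearMap K (lowSum l) := by
  refine isLinearMap_finsum (fun i => isLinearMap_finsum
    (fun j => isLinearMap_mul_pderiv _ _) fun f => ?_) fun f => ?_ <;>
  obtain ⟨N, hN⟩ := exists_pderiv_letter_eq_zero hl f
  · exact ⟨N, fun j hj => by rw [hN (i + j + 1) (by omega), mul_zero]⟩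
  · refine ⟨N, fun i hi => ?_⟩
    have hN' (j : ℕ) : pderiv (l (i + j + 1)) f = 0 := hN _ (by omega)
    simp only [hN', mul_zero, finsum_zero]

lemma isLinearMap_raiseSum : IsLinearMap K (raiseSum l) := by
  refine isLinearMap_finsum (fun i => isLinearMap_finsum
    (fun j => (isLinearMap_mul_pderiv_pderiv _ _ _).const_smul _) fun f => ?_) fun f => ?_
  · obtain ⟨N, hN⟩ := exists_pderiv_letter_eq_zero hl f
    exact ⟨N, fun j hj => by rw [hN j hj, map_zero, mul_zero, smul_zero]⟩
  · obtain ⟨N, hN⟩ := exists_pderiv_letter_eq_zero (l := Var.p) (fun _ _ => Var.p.inj) f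
    refine ⟨N, fun i hi => ?_⟩
    simp only [pderiv_pderiv_comm (Var.p _), hN (i + 1) (by omega), map_zero, mul_zero,
      smul_zero, finsum_zero]

lemma isLinearMap_Lam : IsLinearMap K (Lam l) :=
  (((isLinearMap_raiseSum hl).const_smul _).add_fun (isLinearMap_lowSum hl)).add_fun
    ((isLinearMap_eulSum hl).const_smul _)

omit hl
include hl1 hl2

lemma isLinearMap_triSum (r1 r2 : ℕ → Var) : IsLinearMap K (triSum r1 r2 l1 l2) := by
  refine isLinearMap_finsum (fun i => isLinearMap_finsum (fun j => isLinearMap_finsum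
    (fun k => isLinearMap_mul_pderiv_pderiv _ _ _) fun f => ?_) fun f => ?_) fun f => ?_
  · obtain ⟨N, hN⟩ := exists_pderiv_letter_eq_zero hl1 (pderiv (l2 j) f)
    exact ⟨N, fun k hk => by rw [hN (i + k + 1) (by omega), mul_zero]⟩
  · obtain ⟨N, hN⟩ := exists_pderiv_letter_eq_zero hl2 f
    exact ⟨N, fun j hj => by simp only [hN j hj, map_zero, mul_zero, finsum_zero]⟩
  · obtain ⟨N, hN⟩ := exists_pderiv_letter_eq_zero hl1 f
    refine ⟨N, fun i hi => ?_⟩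
    have hN' (j : ℕ) : pderiv (l1 (i + j + 1)) f = 0 := hN _ (by omega)
    simp only [pderiv_pderiv_comm (l1 _), hN', map_zero, mul_zero, finsum_zero]

lemma isLinearMap_biSum (r1 r2 : ℕ → Var) : IsLinearMap K (biSum r1 r2 l1 l2) := by
  refine isLinearMap_finsum (fun i => isLinearMap_finsum
    (fun j => isLinearMap_mul_pderiv_pderiv _ _ _) fun f => ?_) fun f => ?_
  · obtain ⟨N, hN⟩ := exists_pderiv_letter_eq_zero hl2 f
    exact ⟨N, fun j hj => by simp only [hN j hj, map_zero, mul_zero]⟩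
  · obtain ⟨N, hN⟩ := exists_pderiv_letter_eq_zero hl1 f
    refine ⟨N, fun i hi => ?_⟩
    simp only [pderiv_pderiv_comm (l1 _), hN i hi, map_zero, mul_zero, finsum_zero]

end Letters

lemma Var.y_injective : Function.Injective Var.y := fun _ _ => Var.y.inj

lemma Var.y'_injective : Function.Injective Var.y' := fun _ _ => Var.y'.inj

lemma Var.z_injective : Function.Injective Var.z := fun _ _ => Var.z.inj

lemma Var.z'_injective : Function.Injective Var.z' := fun _ _ => Var.z'.inj

lemma Var.p_injective : Function.Injective Var.p := fun _ _ => Var.p.inj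

lemma isLinearMap_MZ : IsLinearMap K MZ :=
  (((isLinearMap_triSum Var.y_injective Var.z_injective _ _).const_smul _).add_fun
    (isLinearMap_triSum Var.y'_injective Var.z'_injective _ _)).add_fun
    ((isLinearMap_triSum Var.y'_injective Var.z'_injective _ _).const_smul _)

lemma isLinearMap_MY : IsLinearMap K MY :=
  (((isLinearMap_triSum Var.z_injective Var.y_injective _ _).const_smul _).add_fun
    (isLinearMap_triSum Var.z'_injective Var.y'_injective _ _)).add_fun
    ((isLinearMap_triSum Var.z'_injective Var.y'_injective _ _).const_smul _)

lemma isLinearMap_Delta : IsLinearMap K Delta :=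
  (((isLinearMap_biSum Var.y_injective Var.z_injective _ _).const_smul _).add_fun
    (isLinearMap_biSum Var.y'_injective Var.z'_injective _ _)).add_fun
    ((isLinearMap_biSum Var.y'_injective Var.z'_injective _ _).const_smul _)

lemma isLinearMap_LamYt : IsLinearMap K LamYt :=
  ((isLinearMap_Lam Var.y_injective).add_fun (isLinearMap_Lam Var.y'_injective)).add_fun
    isLinearMap_MY

lemma isLinearMap_LamZt : IsLinearMap K LamZt :=
  ((isLinearMap_Lam Var.z_injective).add_fun (isLinearMap_Lam Var.z'_injective)).add_fun
    isLinearMap_MZ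

lemma isLinearMap_Ytplus : IsLinearMap K Ytplus :=
  (isLinearMap_Plus Var.y_injective).add_fun (isLinearMap_Plus Var.y'_injective)

lemma isLinearMap_Ztplus : IsLinearMap K Ztplus :=
  (isLinearMap_Plus Var.z_injective).add_fun (isLinearMap_Plus Var.z'_injective)

lemma isLinearMap_YL (n : ℕ) : IsLinearMap K (YL n) :=
  isLinearMap_comp isLinearMap_Ytplus (isLinearMap_iterate isLinearMap_LamYt n)

lemma isLinearMap_ZL (n : ℕ) : IsLinearMap K (ZL n) :=
  isLinearMap_comp isLinearMap_Ztplus (isLinearMap_iterate isLinearMap_LamZt n)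

end Locality

section Letters

/-- The polynomials not involving the letter `l`. -/
def freeOf (l : ℕ → Var) : Subalgebra K R where
  carrier := {g | ∀ i, pderiv (l i) g = 0}
  mul_mem' hf hg i := by rw [Derivation.leibniz, hf i, hg i, smul_zero, smul_zero, add_zero]
  add_mem' hf hg i := by rw [map_add, hf i, hg i, add_zero]
  algebraMap_mem' r i := pderiv_C

lemma pderiv_eq_zero_of_mem {l : ℕ → Var} {g : R} (hg : g ∈ freeOf l) (i : ℕ) :
    pderiv (l i) g = 0 := hg i

lemma X_mem_freeOf {l : ℕ → Var} {v : Var} (h : ∀ i, l i ≠ v) : (X v : R) ∈ freeOf l :=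
  fun i => pderiv_X_of_ne (h i).symm

lemma rename_mem_freeOf {l : ℕ → Var} (hl : ∀ i j, l i ≠ Var.p j) (f : PPoly) :
    rename Var.p f ∈ freeOf l := fun i => pderiv_eq_zero_of_notMem_vars fun h => by
  obtain ⟨j, _, hj⟩ := Finset.mem_image.1 (vars_rename Var.p f h)
  exact hl i j hj.symm

lemma pderiv_mem_freeOf {l : ℕ → Var} {g : R} (hg : g ∈ freeOf l) (v : Var) :
    pderiv v g ∈ freeOf l := fun i => by
  rw [pderiv_pderiv_comm, pderiv_eq_zero_of_mem hg, map_zero]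

lemma pderiv_X_mul_s11 {l : ℕ → Var} (hl : l.Injective) {g : R} (hg : g ∈ freeOf l) (i a : ℕ) :
    pderiv (l i) (X (l a) * g) = if i = a then g else 0 := by
  rw [Derivation.leibniz, pderiv_eq_zero_of_mem hg, smul_zero, zero_add]
  split_ifs with h
  · rw [h, pderiv_X_self, smul_eq_mul, mul_one]
  · rw [pderiv_X_of_ne fun h' => h (hl h').symm, smul_zero]

section Vanishing

variable {l : ℕ → Var} {g : R} (hg : g ∈ freeOf l)
include hg

lemma Plus_eq_zero : Plus l g = 0 := by
  simp [Plus, pderiv_eq_zero_of_mem hg]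

lemma Lam_eq_zero : Lam l g = 0 := by
  simp [Lam, pderiv_eq_zero_of_mem hg]

lemma triSum_eq_zero_right (r1 r2 l1 : ℕ → Var) : triSum r1 r2 l1 l g = 0 := by
  simp [triSum, pderiv_eq_zero_of_mem hg]

lemma triSum_eq_zero_left (r1 r2 l2 : ℕ → Var) : triSum r1 r2 l l2 g = 0 := by
  simp [triSum, pderiv_pderiv_comm (l _), pderiv_eq_zero_of_mem hg]

lemma biSum_eq_zero_right (r1 r2 l1 : ℕ → Var) : biSum r1 r2 l1 l g = 0 := by
  simp [biSum, pderiv_eq_zero_of_mem hg]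

lemma biSum_eq_zero_left (r1 r2 l2 : ℕ → Var) : biSum r1 r2 l l2 g = 0 := by
  simp [biSum, pderiv_pderiv_comm (l _), pderiv_eq_zero_of_mem hg]

end Vanishing

section Preservation

variable {l n : ℕ → Var} {g : R} (hn : ∀ i j, n i ≠ l j) (hg : g ∈ freeOf n)
include hn hg

lemma Plus_mem_freeOf : Plus l g ∈ freeOf n :=
  finsum_induction (· ∈ freeOf n) (zero_mem _) (fun _ _ => add_mem) fun _ =>
    mul_mem (X_mem_freeOf fun _ => hn _ _) (pderiv_mem_freeOf hg _)

lemma Lam_mem_freeOf (hp : ∀ i j, n i ≠ Var.p j) : Lam l g ∈ freeOf n := by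
  refine add_mem (add_mem (Subalgebra.smul_mem _ ?_ _) ?_) (Subalgebra.smul_mem _ ?_ _)
  · exact finsum_induction (· ∈ freeOf n) (zero_mem _) (fun _ _ => add_mem) fun _ =>
      finsum_induction (· ∈ freeOf n) (zero_mem _) (fun _ _ => add_mem) fun _ =>
        Subalgebra.smul_mem _ (mul_mem (X_mem_freeOf fun _ => hn _ _)
          (pderiv_mem_freeOf (pderiv_mem_freeOf hg _) _)) _
  · exact finsum_induction (· ∈ freeOf n) (zero_mem _) (fun _ _ => add_mem) fun _ =>
      finsum_induction (· ∈ freeOf n) (zero_mem _) (fun _ _ => add_mem) fun _ =>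
        mul_mem (mul_mem (X_mem_freeOf fun _ => hn _ _) (X_mem_freeOf fun _ => hp _ _))
          (pderiv_mem_freeOf hg _)
  · exact finsum_induction (· ∈ freeOf n) (zero_mem _) (fun _ _ => add_mem) fun _ =>
      Subalgebra.smul_mem _ (mul_mem (X_mem_freeOf fun _ => hn _ _) (pderiv_mem_freeOf hg _)) _

end Preservation

section Evaluation

variable {l : ℕ → Var} (hl : l.Injective) {g : R} (hg : g ∈ freeOf l) (a : ℕ)
include hl hg

lemma Plus_X_mul : Plus l (X (l a) * g) = X (l (a + 1)) * g := by
  simp only [Plus, pderiv_X_mul_s11 hl hg]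
  rw [finsum_eq_single _ a fun i hi => by rw [if_neg hi, mul_zero], if_pos rfl]

lemma eulSum_X_mul : eulSum l (X (l a) * g) = (a : K) • (X (l a) * g) := by
  simp only [eulSum, pderiv_X_mul_s11 hl hg]
  cases a with
  | zero => simp
  | succ a =>
    rw [finsum_eq_single _ a fun i hi => by
      rw [if_neg (by omega), mul_zero, smul_zero], if_pos rfl]

lemma lowSum_X_mul : lowSum l (X (l a) * g) =
    ∑ k ∈ Finset.range a, X (l k) * X (Var.p (a - k)) * g := by
  simp only [lowSum, pderiv_X_mul_s11 hl hg]
  rw [finsum_eq_sum_range (N := a) fun i hi => ?_]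
  · refine Finset.sum_congr rfl fun k hk => ?_
    rw [Finset.mem_range] at hk
    rw [finsum_eq_single _ (a - k - 1) fun j hj => by rw [if_neg (by omega), mul_zero],
      if_pos (by omega), show a - k - 1 + 1 = a - k by omega]
  · refine finsum_eq_zero_of_forall_eq_zero fun j => ?_
    rw [if_neg (by omega), mul_zero]

lemma raiseSum_X_mul (hp : ∀ i j, l i ≠ Var.p j) {N : ℕ}
    (hN : ∀ i, N ≤ i → pderiv (Var.p i) g = 0) :
    raiseSum l (X (l a) * g) =
      ∑ i ∈ Finset.range N, (i : K) • (X (l (a + i)) * pderiv (Var.p i) g) := by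
  have hpX (i : ℕ) : pderiv (Var.p i) (X (l a) * g) = X (l a) * pderiv (Var.p i) g := by
    rw [Derivation.leibniz, pderiv_X_of_ne (hp _ _), smul_zero, add_zero, smul_eq_mul]
  have hs : raiseSum l (X (l a) * g) =
      ∑ᶠ i : ℕ, ((i + 1 : ℕ) : K) • (X (l (a + (i + 1))) * pderiv (Var.p (i + 1)) g) := by
    refine finsum_congr fun i => ?_
    rw [finsum_eq_single _ a fun j hj => ?_]
    · rw [pderiv_pderiv_comm, hpX, pderiv_X_mul_s11 hl (pderiv_mem_freeOf hg _), if_pos rfl,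
        show i + a + 1 = a + (i + 1) by omega]
    · rw [pderiv_pderiv_comm, hpX, pderiv_X_mul_s11 hl (pderiv_mem_freeOf hg _), if_neg hj, mul_zero,
        smul_zero]
  have hsum : ∑ i ∈ Finset.range N, (i : K) • (X (l (a + i)) * pderiv (Var.p i) g)
      = ∑ i ∈ Finset.range (N + 1), (i : K) • (X (l (a + i)) * pderiv (Var.p i) g) := by
    rw [Finset.sum_range_succ, hN N le_rfl, mul_zero, smul_zero, add_zero]
  rw [hs, hsum, Finset.sum_range_succ', Nat.cast_zero, zero_smul, add_zero,
    finsum_eq_sum_range (N := N) fun i hi => by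
      rw [hN (i + 1) (by omega), mul_zero, smul_zero]]

end Evaluation

section EvaluationPair

variable {l m : ℕ → Var} (hl : l.Injective) (hm : m.Injective) (hlm : ∀ i j, l i ≠ m j)
  {g : R} (hgl : g ∈ freeOf l) (hgm : g ∈ freeOf m) (a c : ℕ)
include hl hm hlm hgl hgm

lemma pderiv_pderiv_X_mul_X_mul (i j : ℕ) :
    pderiv (l i) (pderiv (m j) (X (l a) * X (m c) * g)) =
      if i = a then if j = c then g else 0 else 0 := by
  rw [mul_assoc, mul_left_comm,
    pderiv_X_mul_s11 hm (mul_mem (X_mem_freeOf fun _ => (hlm _ _).symm) hgm)]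
  by_cases hj : j = c
  · rw [if_pos hj, if_pos hj, pderiv_X_mul_s11 hl hgl]
  · rw [if_neg hj, if_neg hj, map_zero, ite_self]

lemma biSum_X_mul_X_mul (r1 r2 : ℕ → Var) :
    biSum r1 r2 l m (X (l a) * X (m c) * g) = X (r1 a) * X (r2 c) * g := by
  simp only [biSum, pderiv_pderiv_X_mul_X_mul hl hm hlm hgl hgm]
  rw [finsum_eq_single _ a fun i hi => by simp [hi], finsum_eq_single _ c fun j hj => by simp [hj],
    if_pos rfl, if_pos rfl]

lemma triSum_X_mul_X_mul (r1 r2 : ℕ → Var) :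
    triSum r1 r2 l m (X (l a) * X (m c) * g) =
      ∑ k ∈ Finset.range a, X (r1 (a + c - k)) * X (r2 k) * g := by
  simp only [triSum, pderiv_pderiv_X_mul_X_mul hl hm hlm hgl hgm]
  rw [← Finset.sum_range_reflect, finsum_eq_sum_range (N := a) fun i hi => ?_]
  · refine Finset.sum_congr rfl fun i hi => ?_
    rw [Finset.mem_range] at hi
    rw [finsum_eq_single _ c fun j hj => by simp [hj],
      finsum_eq_single _ (a - 1 - i) fun k hk => by rw [if_neg (by omega), mul_zero],
      if_pos (by omega), if_pos rfl, show a + c - (a - 1 - i) = i + c + 1 by omega]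
  · refine finsum_eq_zero_of_forall_eq_zero fun j => finsum_eq_zero_of_forall_eq_zero fun k => ?_
    rw [if_neg (by omega), mul_zero]

end EvaluationPair

end Letters

section PairMap

/-- The map `f u^a v^c ↦ l_a m_c f` from the two-particle space to polynomials. -/
def pairL (l m : ℕ → Var) : TwoPart →ₗ[K] R :=
  Finsupp.lsum K fun ac =>
    LinearMap.mulLeft K (X (l ac.1) * X (m ac.2)) ∘ₗ (rename (R := K) Var.p).toLinearMap

lemma pairL_elt (l m : ℕ → Var) (a c : ℕ) (f : PPoly) :
    pairL l m (elt a c f) = X (l a) * X (m c) * rename Var.p f :=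
  Finsupp.lsum_single _ _ _ _

lemma apply_pairL {F : R → R} (hF : IsLinearMap K F) {l m : ℕ → Var} (H : TwoPart →ₗ[K] R)
    (h : ∀ a c f, F (X (l a) * X (m c) * rename Var.p f) = H (elt a c f)) (x : TwoPart) :
    F (pairL l m x) = H x := by
  have : hF.mk' F ∘ₗ pairL l m = H := Finsupp.lhom_ext fun ac f => by
    exact (congrArg F (pairL_elt l m ac.1 ac.2 f)).trans (h ac.1 ac.2 f)
  exact LinearMap.congr_fun this x

lemma pairL_swapUV (l m : ℕ → Var) (x : TwoPart) : pairL l m (swapUV x) = pairL m l x := by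
  have : pairL l m ∘ₗ swapUV = pairL m l := Finsupp.lhom_ext fun ac f => by
    change pairL l m (swapUV (elt ac.1 ac.2 f)) = pairL m l (elt ac.1 ac.2 f)
    rw [swapUV_elt, pairL_elt, pairL_elt, mul_comm (X (l _))]
  exact LinearMap.congr_fun this x

lemma pairL_mem_freeOf {l m n : ℕ → Var} (hnl : ∀ i j, n i ≠ l j) (hnm : ∀ i j, n i ≠ m j)
    (hnp : ∀ i j, n i ≠ Var.p j) (x : TwoPart) : pairL l m x ∈ freeOf n := by
  induction x using Finsupp.induction_linear with
  | zero => rw [map_zero]; exact zero_mem _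
  | add x y hx hy => rw [map_add]; exact add_mem hx hy
  | single ac f =>
    change pairL l m (elt ac.1 ac.2 f) ∈ _
    rw [pairL_elt]
    exact mul_mem (mul_mem (X_mem_freeOf fun _ => hnl _ _) (X_mem_freeOf fun _ => hnm _ _))
      (rename_mem_freeOf hnp f)

section Intertwining

variable {l m : ℕ → Var} (hl : l.Injective) (hm : m.Injective) (hlm : ∀ i j, l i ≠ m j)
  (hlp : ∀ i j, l i ≠ Var.p j) (hmp : ∀ i j, m i ≠ Var.p j) (x : TwoPart)
include hl hlm hlp

lemma Plus_pairL : Plus l (pairL l m x) = pairL l m (mulU x) :=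
  apply_pairL (isLinearMap_Plus hl) (pairL l m ∘ₗ mulU) (fun a c f => by
    rw [mul_assoc, Plus_X_mul hl (mul_mem (X_mem_freeOf fun _ => hlm _ _)
      (rename_mem_freeOf hlp f)), LinearMap.comp_apply, mulU_elt, pairL_elt, mul_assoc]) x

lemma eulSum_pairL : eulSum l (pairL l m x) = pairL l m (eulU x) :=
  apply_pairL (isLinearMap_eulSum hl) (pairL l m ∘ₗ eulU) (fun a c f => by
    rw [mul_assoc, eulSum_X_mul hl (mul_mem (X_mem_freeOf fun _ => hlm _ _)
      (rename_mem_freeOf hlp f)), LinearMap.comp_apply, eulU_elt, map_smul, pairL_elt,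
      mul_assoc]) x

lemma lowSum_pairL : lowSum l (pairL l m x) = pairL l m (lowU x) :=
  apply_pairL (isLinearMap_lowSum hl) (pairL l m ∘ₗ lowU) (fun a c f => by
    rw [mul_assoc, lowSum_X_mul hl (mul_mem (X_mem_freeOf fun _ => hlm _ _)
      (rename_mem_freeOf hlp f)), LinearMap.comp_apply, lowU_elt, map_sum]
    refine Finset.sum_congr rfl fun k _ => ?_
    rw [pairL_elt, map_mul, rename_X]
    ring) x

include hmp

lemma raiseSum_pairL : raiseSum l (pairL l m x) = pairL l m (raiseU x) :=
  apply_pairL (isLinearMap_raiseSum hl) (pairL l m ∘ₗ raiseU) (fun a c f => by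
    obtain ⟨N, hN⟩ := exists_pderiv_eq_zero f
    have hp (i : ℕ) : pderiv (Var.p i) (X (m c) * rename Var.p f) =
        X (m c) * rename Var.p (pderiv i f) := by
      rw [Derivation.leibniz, pderiv_X_of_ne (hmp _ _), smul_zero, add_zero, smul_eq_mul,
        pderiv_rename Var.p_injective]
    rw [mul_assoc, raiseSum_X_mul hl (mul_mem (X_mem_freeOf fun _ => hlm _ _)
      (rename_mem_freeOf hlp f)) a hlp (N := N) fun i hi => by rw [hp, hN i hi, map_zero, mul_zero],
      LinearMap.comp_apply, raiseU_elt _ _ hN, map_sum]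
    refine Finset.sum_congr rfl fun i _ => ?_
    rw [hp, map_smul, pairL_elt, mul_assoc]) x

lemma Lam_pairL_left : Lam l (pairL l m x) = pairL l m (lamY 0 x) := by
  rw [Lam_eq, raiseSum_pairL hl hlm hlp hmp, lowSum_pairL hl hlm hlp, eulSum_pairL hl hlm hlp]
  simp [lamY]

omit hl hlm hlp hmp

lemma pairL_swapUV_of_comm {F G : Module.End K TwoPart} (h : swapUV * F = G * swapUV) :
    pairL m l (F (swapUV x)) = pairL l m (G x) := by
  rw [← pairL_swapUV l m, ← Module.End.mul_apply, ← Module.End.mul_apply, h, mul_assoc,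
    swapUV_mul_swapUV, mul_one]

include hm hlm hmp

lemma Plus_pairL_right : Plus m (pairL l m x) = pairL l m (mulV x) := by
  rw [← pairL_swapUV m l x, Plus_pairL hm (fun i j => (hlm j i).symm) hmp,
    pairL_swapUV_of_comm _ swapUV_mul_mulU]

include hlp in
lemma Lam_pairL_right : Lam m (pairL l m x) = pairL l m (lamZ 0 x) := by
  rw [← pairL_swapUV m l x, Lam_pairL_left hm (fun i j => (hlm j i).symm) hmp hlp,
    pairL_swapUV_of_comm _ (swapUV_mul_lamY 0)]

include hl hlp

lemma biSum_pairL (r1 r2 : ℕ → Var) : biSum r1 r2 l m (pairL l m x) = pairL r1 r2 x :=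
  apply_pairL (isLinearMap_biSum hl hm r1 r2) (pairL r1 r2) (fun a c f => by
    rw [biSum_X_mul_X_mul hl hm hlm (rename_mem_freeOf hlp f) (rename_mem_freeOf hmp f),
      pairL_elt]) x

lemma triSum_pairL_left (r1 r2 : ℕ → Var) :
    triSum r1 r2 l m (pairL l m x) = pairL r1 r2 (divZ x) :=
  apply_pairL (isLinearMap_triSum hl hm r1 r2) (pairL r1 r2 ∘ₗ divZ) (fun a c f => by
    rw [triSum_X_mul_X_mul hl hm hlm (rename_mem_freeOf hlp f) (rename_mem_freeOf hmp f),
      LinearMap.comp_apply, divZ_elt, map_sum]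
    simp only [pairL_elt]) x

lemma triSum_pairL_right (r1 r2 : ℕ → Var) :
    triSum r1 r2 m l (pairL l m x) = pairL r2 r1 (divY x) := by
  rw [← pairL_swapUV m l x, triSum_pairL_left hm hl (fun i j => (hlm j i).symm) hmp hlp,
    pairL_swapUV_of_comm _ swapUV_mul_divZ]

end Intertwining

end PairMap

section Doubled

lemma pairL_yz_mem_freeOf_y' (x : TwoPart) : pairL Var.y Var.z x ∈ freeOf Var.y' :=
  pairL_mem_freeOf (by simp) (by simp) (by simp) x

lemma pairL_yz_mem_freeOf_z' (x : TwoPart) : pairL Var.y Var.z x ∈ freeOf Var.z' :=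
  pairL_mem_freeOf (by simp) (by simp) (by simp) x

lemma pairL_primed_mem_freeOf_y (x : TwoPart) : pairL Var.y' Var.z' x ∈ freeOf Var.y :=
  pairL_mem_freeOf (by simp) (by simp) (by simp) x

lemma pairL_primed_mem_freeOf_z (x : TwoPart) : pairL Var.y' Var.z' x ∈ freeOf Var.z :=
  pairL_mem_freeOf (by simp) (by simp) (by simp) x

lemma Ytplus_pairL_yz (x : TwoPart) :
    Ytplus (pairL Var.y Var.z x) = pairL Var.y Var.z (mulU x) := by
  rw [Ytplus, Plus_pairL Var.y_injective (by simp) (by simp),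
    Plus_eq_zero (pairL_yz_mem_freeOf_y' x), add_zero]

lemma Ytplus_pairL_primed (x : TwoPart) :
    Ytplus (pairL Var.y' Var.z' x) = pairL Var.y' Var.z' (mulU x) := by
  rw [Ytplus, Plus_pairL Var.y'_injective (by simp) (by simp),
    Plus_eq_zero (pairL_primed_mem_freeOf_y x), zero_add]

lemma Ztplus_pairL_yz (x : TwoPart) :
    Ztplus (pairL Var.y Var.z x) = pairL Var.y Var.z (mulV x) := by
  rw [Ztplus, Plus_pairL_right Var.z_injective (by simp) (by simp),
    Plus_eq_zero (pairL_yz_mem_freeOf_z' x), add_zero]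

lemma Ztplus_pairL_primed (x : TwoPart) :
    Ztplus (pairL Var.y' Var.z' x) = pairL Var.y' Var.z' (mulV x) := by
  rw [Ztplus, Plus_pairL_right Var.z'_injective (by simp) (by simp),
    Plus_eq_zero (pairL_primed_mem_freeOf_z x), zero_add]

lemma LamYt_pairL_yz (x : TwoPart) : LamYt (pairL Var.y Var.z x) =
    pairL Var.y Var.z (lamY 0 x) + alpha • pairL Var.y' Var.z' (divY x) := by
  rw [LamYt, Lam_pairL_left Var.y_injective (by simp) (by simp) (by simp),
    Lam_eq_zero (pairL_yz_mem_freeOf_y' x), MY_eq,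
    triSum_pairL_right Var.y_injective Var.z_injective (by simp) (by simp) (by simp),
    triSum_eq_zero_right (pairL_yz_mem_freeOf_y' x),
    triSum_eq_zero_right (pairL_yz_mem_freeOf_y' x),
    smul_zero, add_zero, add_zero, add_zero]

lemma LamYt_pairL_primed (x : TwoPart) : LamYt (pairL Var.y' Var.z' x) =
    pairL Var.y' Var.z' (lamY 0 x)
      + (pairL Var.y Var.z (divY x) + bb • pairL Var.y' Var.z' (divY x)) := by
  rw [LamYt, Lam_pairL_left Var.y'_injective (by simp) (by simp) (by simp),
    Lam_eq_zero (pairL_primed_mem_freeOf_y x), MY_eq,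
    triSum_pairL_right Var.y'_injective Var.z'_injective (by simp) (by simp) (by simp),
    triSum_pairL_right Var.y'_injective Var.z'_injective (by simp) (by simp) (by simp),
    triSum_eq_zero_right (pairL_primed_mem_freeOf_y x), smul_zero, zero_add, zero_add]

lemma LamZt_pairL_yz (x : TwoPart) : LamZt (pairL Var.y Var.z x) =
    pairL Var.y Var.z (lamZ 0 x) + alpha • pairL Var.y' Var.z' (divZ x) := by
  rw [LamZt, Lam_pairL_right Var.z_injective (by simp) (by simp) (by simp),
    Lam_eq_zero (pairL_yz_mem_freeOf_z' x), MZ_eq,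
    triSum_pairL_left Var.y_injective Var.z_injective (by simp) (by simp) (by simp),
    triSum_eq_zero_right (pairL_yz_mem_freeOf_z' x),
    triSum_eq_zero_right (pairL_yz_mem_freeOf_z' x),
    smul_zero, add_zero, add_zero, add_zero]

lemma LamZt_pairL_primed (x : TwoPart) : LamZt (pairL Var.y' Var.z' x) =
    pairL Var.y' Var.z' (lamZ 0 x)
      + (pairL Var.y Var.z (divZ x) + bb • pairL Var.y' Var.z' (divZ x)) := by
  rw [LamZt, Lam_pairL_right Var.z'_injective (by simp) (by simp) (by simp),
    Lam_eq_zero (pairL_primed_mem_freeOf_z x), MZ_eq,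
    triSum_pairL_left Var.y'_injective Var.z'_injective (by simp) (by simp) (by simp),
    triSum_pairL_left Var.y'_injective Var.z'_injective (by simp) (by simp) (by simp),
    triSum_eq_zero_right (pairL_primed_mem_freeOf_z x), smul_zero, zero_add, zero_add]

lemma Delta_pairL_yz (x : TwoPart) :
    Delta (pairL Var.y Var.z x) = alpha • pairL Var.y' Var.z' (swapUV x) := by
  rw [Delta_eq, biSum_pairL Var.y_injective Var.z_injective (by simp) (by simp) (by simp),
    biSum_eq_zero_right (pairL_yz_mem_freeOf_z' x), biSum_eq_zero_right (pairL_yz_mem_freeOf_z' x),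
    smul_zero, add_zero, add_zero, pairL_swapUV]

lemma Delta_pairL_primed (x : TwoPart) : Delta (pairL Var.y' Var.z' x) =
    pairL Var.y Var.z (swapUV x) + bb • pairL Var.y' Var.z' (swapUV x) := by
  rw [Delta_eq, biSum_pairL Var.y'_injective Var.z'_injective (by simp) (by simp) (by simp),
    biSum_pairL Var.y'_injective Var.z'_injective (by simp) (by simp) (by simp),
    biSum_eq_zero_right (pairL_primed_mem_freeOf_z x), smul_zero, zero_add, pairL_swapUV,
    pairL_swapUV]

/-- The embedding `f u^a v^c ↦ (y_a z_c + t y′_a z′_c) f` of the two-particle space. -/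
def doubleL (t : K) : TwoPart →ₗ[K] R := pairL Var.y Var.z + t • pairL Var.y' Var.z'

lemma doubleL_apply (t : K) (x : TwoPart) :
    doubleL t x = pairL Var.y Var.z x + t • pairL Var.y' Var.z' x := rfl

lemma Ytplus_doubleL (t : K) (x : TwoPart) : Ytplus (doubleL t x) = doubleL t (mulU x) := by
  rw [doubleL_apply, isLinearMap_Ytplus.map_add, isLinearMap_Ytplus.map_smul, Ytplus_pairL_yz,
    Ytplus_pairL_primed, doubleL_apply]

lemma Ztplus_doubleL (t : K) (x : TwoPart) : Ztplus (doubleL t x) = doubleL t (mulV x) := by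
  rw [doubleL_apply, isLinearMap_Ztplus.map_add, isLinearMap_Ztplus.map_smul, Ztplus_pairL_yz,
    Ztplus_pairL_primed, doubleL_apply]

lemma lamY_apply (t : K) (x : TwoPart) : lamY t x = lamY 0 x + t • divY x := by
  simp [lamY]

lemma lamZ_apply (t : K) (x : TwoPart) : lamZ t x = lamZ 0 x + t • divZ x := by
  simp [lamZ]

variable {t : K} (ht : t * t = bb * t + alpha)
include ht

lemma LamYt_doubleL (x : TwoPart) : LamYt (doubleL t x) = doubleL t (lamY t x) := by
  rw [doubleL_apply, isLinearMap_LamYt.map_add, isLinearMap_LamYt.map_smul, LamYt_pairL_yz,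
    LamYt_pairL_primed, doubleL_apply, lamY_apply t, map_add, map_smul,
    map_add, map_smul]
  simp only [smul_add, smul_smul, ht, add_smul, mul_comm t bb]
  abel

lemma LamZt_doubleL (x : TwoPart) : LamZt (doubleL t x) = doubleL t (lamZ t x) := by
  rw [doubleL_apply, isLinearMap_LamZt.map_add, isLinearMap_LamZt.map_smul, LamZt_pairL_yz,
    LamZt_pairL_primed, doubleL_apply, lamZ_apply t, map_add, map_smul,
    map_add, map_smul]
  simp only [smul_add, smul_smul, ht, add_smul, mul_comm t bb]
  abel

lemma Delta_doubleL (x : TwoPart) : Delta (doubleL t x) = doubleL t ((t • swapUV) x) := by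
  rw [doubleL_apply, isLinearMap_Delta.map_add, isLinearMap_Delta.map_smul, Delta_pairL_yz,
    Delta_pairL_primed, LinearMap.smul_apply, map_smul, doubleL_apply]
  simp only [smul_add, smul_smul, ht, add_smul, mul_comm t bb]
  abel

lemma YL_doubleL (n : ℕ) (x : TwoPart) :
    YL n (doubleL t x) = doubleL t ((mulU * lamY t ^ n) x) := by
  have h : Function.Semiconj (doubleL t) (lamY t) LamYt := fun x => (LamYt_doubleL ht x).symm
  rw [YL, ← (h.iterate_right n) x, Ytplus_doubleL, Module.End.mul_apply, Module.End.pow_apply]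

lemma ZL_doubleL (n : ℕ) (x : TwoPart) :
    ZL n (doubleL t x) = doubleL t ((mulV * lamZ t ^ n) x) := by
  have h : Function.Semiconj (doubleL t) (lamZ t) LamZt := fun x => (LamZt_doubleL ht x).symm
  rw [ZL, ← (h.iterate_right n) x, Ztplus_doubleL, Module.End.mul_apply, Module.End.pow_apply]

end Doubled

section Commutation

/-- The difference of the two sides of the symmetrized commutation identity. -/
def defect (m n : ℕ) (f : R) : R :=
  (ZL (m + 1) (YL n f) - YL n (ZL (m + 1) f)) + (ZL (n + 1) (YL m f) - YL m (ZL (n + 1) f))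
    - (YL n (ZL m (Delta f)) + YL m (ZL n (Delta f)))

lemma isLinearMap_defect (m n : ℕ) : IsLinearMap K (defect m n) :=
  let Y (n : ℕ) : Module.End K R := (isLinearMap_YL n).mk' _
  let Z (n : ℕ) : Module.End K R := (isLinearMap_ZL n).mk' _
  let D : Module.End K R := isLinearMap_Delta.mk' _
  ((Z (m + 1) * Y n - Y n * Z (m + 1)) + (Z (n + 1) * Y m - Y m * Z (n + 1))
    - (Y n * (Z m * D) + Y m * (Z n * D))).isLinear

lemma defect_doubleL (m n : ℕ) {t : K} (ht : t * t = bb * t + alpha) (x : TwoPart) :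
    defect m n (doubleL t x) = 0 := by
  simp only [defect, Delta_doubleL ht, ZL_doubleL ht, YL_doubleL ht, ← map_add, ← map_sub]
  have h := LinearMap.congr_fun (symmetrized_commutation_model ht m n) x
  exact (congrArg (doubleL t) (sub_eq_zero.2 h)).trans (map_zero _)

lemma one_add_alpha_ne_zero : 1 + alpha ≠ 0 := by
  have h : (1 + alpha : K) = algebraMap (Polynomial ℚ) K (Polynomial.X + Polynomial.C 2) := by
    rw [alpha, bb, map_add, RatFunc.algebraMap_X, RatFunc.algebraMap_C, map_ofNat]
    ring
  rw [h]
  exact RatFunc.algebraMap_ne_zero (Polynomial.X_add_C_ne_zero 2)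

lemma defect_pairL_primed (m n : ℕ) (x : TwoPart) : defect m n (pairL Var.y' Var.z' x) = 0 := by
  have h1 := defect_doubleL m n (t := alpha) (by rw [alpha]; ring) x
  have h2 := defect_doubleL m n (t := -1) (by rw [alpha]; ring) x
  have h : (1 + alpha) • pairL Var.y' Var.z' x = doubleL alpha x - doubleL (-1) x := by
    rw [doubleL_apply, doubleL_apply, add_smul, one_smul, neg_smul, one_smul]
    abel
  refine (smul_eq_zero.1 ?_).resolve_left one_add_alpha_ne_zero
  rw [← (isLinearMap_defect m n).map_smul, h, (isLinearMap_defect m n).map_sub, h1, h2, sub_zero]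

lemma defect_pairL_yz (m n : ℕ) (x : TwoPart) : defect m n (pairL Var.y Var.z x) = 0 := by
  have h := defect_doubleL m n (t := -1) (by rw [alpha]; ring) x
  rwa [doubleL_apply, (isLinearMap_defect m n).map_add, (isLinearMap_defect m n).map_smul,
    defect_pairL_primed, smul_zero, add_zero] at h

end Commutation

section OneParticle

variable {g : R}

section FreeOfZ

variable (hz : g ∈ freeOf Var.z) (hz' : g ∈ freeOf Var.z')
include hz hz'

lemma Ztplus_eq_zero : Ztplus g = 0 := by
  rw [Ztplus, Plus_eq_zero hz, Plus_eq_zero hz', add_zero]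

lemma LamZt_eq_zero : LamZt g = 0 := by
  rw [LamZt, Lam_eq_zero hz, Lam_eq_zero hz', MZ_eq, triSum_eq_zero_right hz,
    triSum_eq_zero_right hz', triSum_eq_zero_right hz', smul_zero, smul_zero]
  simp only [add_zero]

lemma MY_eq_zero : MY g = 0 := by
  rw [MY_eq, triSum_eq_zero_left hz, triSum_eq_zero_left hz', triSum_eq_zero_left hz', smul_zero,
    smul_zero, add_zero, add_zero]

lemma Delta_eq_zero_of_freeOf_z : Delta g = 0 := by
  rw [Delta_eq, biSum_eq_zero_right hz, biSum_eq_zero_right hz', biSum_eq_zero_right hz',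
    smul_zero, smul_zero, add_zero, add_zero]

lemma ZL_eq_zero (n : ℕ) : ZL n g = 0 := by
  cases n with
  | zero => exact Ztplus_eq_zero hz hz'
  | succ n =>
    rw [ZL, Function.iterate_succ_apply, LamZt_eq_zero hz hz',
      (isLinearMap_iterate isLinearMap_LamZt n).map_zero, isLinearMap_Ztplus.map_zero]

lemma LamYt_iterate_mem_freeOf (n : ℕ) :
    LamYt^[n] g ∈ freeOf Var.z ∧ LamYt^[n] g ∈ freeOf Var.z' := by
  induction n with
  | zero => exact ⟨hz, hz'⟩
  | succ n ih =>
    rw [Function.iterate_succ_apply', LamYt, MY_eq_zero ih.1 ih.2, add_zero]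
    exact ⟨add_mem (Lam_mem_freeOf (by simp) ih.1 (by simp))
        (Lam_mem_freeOf (by simp) ih.1 (by simp)),
      add_mem (Lam_mem_freeOf (by simp) ih.2 (by simp))
        (Lam_mem_freeOf (by simp) ih.2 (by simp))⟩

lemma YL_mem_freeOf (n : ℕ) : YL n g ∈ freeOf Var.z ∧ YL n g ∈ freeOf Var.z' := by
  obtain ⟨h, h'⟩ := LamYt_iterate_mem_freeOf hz hz' n
  exact ⟨add_mem (Plus_mem_freeOf (by simp) h) (Plus_mem_freeOf (by simp) h),
    add_mem (Plus_mem_freeOf (by simp) h') (Plus_mem_freeOf (by simp) h')⟩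

lemma defect_eq_zero_of_freeOf_z (m n : ℕ) : defect m n g = 0 := by
  have h (k l : ℕ) : ZL k (YL l g) = 0 :=
    ZL_eq_zero (YL_mem_freeOf hz hz' l).1 (YL_mem_freeOf hz hz' l).2 k
  simp only [defect, h, ZL_eq_zero hz hz', Delta_eq_zero_of_freeOf_z hz hz',
    (isLinearMap_YL _).map_zero, (isLinearMap_ZL _).map_zero, sub_zero, add_zero]

end FreeOfZ

section FreeOfY

variable (hy : g ∈ freeOf Var.y) (hy' : g ∈ freeOf Var.y')
include hy hy'

lemma Ytplus_eq_zero : Ytplus g = 0 := by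
  rw [Ytplus, Plus_eq_zero hy, Plus_eq_zero hy', add_zero]

lemma LamYt_eq_zero : LamYt g = 0 := by
  rw [LamYt, Lam_eq_zero hy, Lam_eq_zero hy', MY_eq, triSum_eq_zero_right hy,
    triSum_eq_zero_right hy', triSum_eq_zero_right hy', smul_zero, smul_zero]
  simp only [add_zero]

lemma MZ_eq_zero : MZ g = 0 := by
  rw [MZ_eq, triSum_eq_zero_left hy, triSum_eq_zero_left hy', triSum_eq_zero_left hy', smul_zero,
    smul_zero, add_zero, add_zero]

lemma Delta_eq_zero_of_freeOf_y : Delta g = 0 := by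
  rw [Delta_eq, biSum_eq_zero_left hy, biSum_eq_zero_left hy', biSum_eq_zero_left hy',
    smul_zero, smul_zero, add_zero, add_zero]

lemma YL_eq_zero (n : ℕ) : YL n g = 0 := by
  cases n with
  | zero => exact Ytplus_eq_zero hy hy'
  | succ n =>
    rw [YL, Function.iterate_succ_apply, LamYt_eq_zero hy hy',
      (isLinearMap_iterate isLinearMap_LamYt n).map_zero, isLinearMap_Ytplus.map_zero]

lemma LamZt_iterate_mem_freeOf (n : ℕ) :
    LamZt^[n] g ∈ freeOf Var.y ∧ LamZt^[n] g ∈ freeOf Var.y' := by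
  induction n with
  | zero => exact ⟨hy, hy'⟩
  | succ n ih =>
    rw [Function.iterate_succ_apply', LamZt, MZ_eq_zero ih.1 ih.2, add_zero]
    exact ⟨add_mem (Lam_mem_freeOf (by simp) ih.1 (by simp))
        (Lam_mem_freeOf (by simp) ih.1 (by simp)),
      add_mem (Lam_mem_freeOf (by simp) ih.2 (by simp))
        (Lam_mem_freeOf (by simp) ih.2 (by simp))⟩

lemma ZL_mem_freeOf (n : ℕ) : ZL n g ∈ freeOf Var.y ∧ ZL n g ∈ freeOf Var.y' := by
  obtain ⟨h, h'⟩ := LamZt_iterate_mem_freeOf hy hy' n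
  exact ⟨add_mem (Plus_mem_freeOf (by simp) h) (Plus_mem_freeOf (by simp) h),
    add_mem (Plus_mem_freeOf (by simp) h') (Plus_mem_freeOf (by simp) h')⟩

lemma defect_eq_zero_of_freeOf_y (m n : ℕ) : defect m n g = 0 := by
  have h (k l : ℕ) : YL k (ZL l g) = 0 :=
    YL_eq_zero (ZL_mem_freeOf hy hy' l).1 (ZL_mem_freeOf hy hy' l).2 k
  simp only [defect, h, YL_eq_zero hy hy', Delta_eq_zero_of_freeOf_y hy hy',
    (isLinearMap_YL _).map_zero, (isLinearMap_ZL _).map_zero, sub_zero, add_zero]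

end FreeOfY

lemma exists_rename_eq_of_mem_Psub {q : R} (hq : q ∈ Psub) : ∃ f : PPoly, rename Var.p f = q := by
  obtain ⟨f, hf⟩ := exists_rename_eq_of_vars_subset_range q Var.p Var.p_injective
    (mem_supported.1 hq)
  exact ⟨f, hf⟩

lemma defect_eq_zero (m n : ℕ) {f : R} (hf : f ∈ PYZt) : defect m n f = 0 := by
  have hlin := isLinearMap_defect m n
  have hX {l r : ℕ → Var} (hr : ∀ i j, l i ≠ r j) (hp : ∀ i j, l i ≠ Var.p j) (i : ℕ)
      (q : PPoly) : X (r i) * rename Var.p q ∈ freeOf l :=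
    mul_mem (X_mem_freeOf fun _ => hr _ _) (rename_mem_freeOf hp q)
  induction hf using Submodule.span_induction with
  | zero => exact hlin.map_zero
  | add f g _ _ hf hg => rw [hlin.map_add, hf, hg, add_zero]
  | smul r f _ hf => rw [hlin.map_smul, hf, smul_zero]
  | mem f hf =>
    rcases hf with hf | ⟨q, hq, hf⟩
    · obtain ⟨q, rfl⟩ := exists_rename_eq_of_mem_Psub hf
      exact defect_eq_zero_of_freeOf_z (rename_mem_freeOf (by simp) q)
        (rename_mem_freeOf (by simp) q) m n
    · obtain ⟨q, rfl⟩ := exists_rename_eq_of_mem_Psub hq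
      obtain ⟨i, rfl⟩ | ⟨i, rfl⟩ | ⟨i, j, rfl⟩ | ⟨i, rfl⟩ | ⟨i, rfl⟩ | ⟨i, j, rfl⟩ := hf
      · exact defect_eq_zero_of_freeOf_z (hX (by simp) (by simp) i q)
          (hX (by simp) (by simp) i q) m n
      · exact defect_eq_zero_of_freeOf_y (hX (by simp) (by simp) i q)
          (hX (by simp) (by simp) i q) m n
      · rw [← pairL_elt, defect_pairL_yz]
      · exact defect_eq_zero_of_freeOf_z (hX (by simp) (by simp) i q)
          (hX (by simp) (by simp) i q) m n
      · exact defect_eq_zero_of_freeOf_y (hX (by simp) (by simp) i q)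
          (hX (by simp) (by simp) i q) m n
      · rw [← pairL_elt, defect_pairL_primed]

end OneParticle

/-- **Symmetrized commutation identity** (Lemma 4.11 of Chapuy–Dołęga): for all `m, n ≥ 0`,
`[Z̃_+Λ_Z̃^{m+1}, Ỹ_+Λ_Ỹ^{n}] + [Z̃_+Λ_Z̃^{n+1}, Ỹ_+Λ_Ỹ^{m}]
  = Ỹ_+Λ_Ỹ^n Z̃_+Λ_Z̃^m Δ + Ỹ_+Λ_Ỹ^m Z̃_+Λ_Z̃^n Δ` on `𝒫_{Ỹ,Z̃}`. -/
theorem symmetrized_commutation (m n : ℕ) :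
    ∀ f ∈ PYZt,
      (ZL (m + 1) (YL n f) - YL n (ZL (m + 1) f))
        + (ZL (n + 1) (YL m f) - YL m (ZL (n + 1) f))
      = YL n (ZL m (Delta f)) + YL m (ZL n (Delta f)) := by
  intro f hf
  exact sub_eq_zero.1 (defect_eq_zero m n hf)
end
end
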